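/- Let Ω = (x_L,x_R) × (y_L,y_R) with x_L < x_R, y_L < y_R, let T > 0, and let u : ℝ × ℝ × ℝ → ℝ, written u(x,y,t), be four times continuously differentiable, spatially periodic with periods L₁ = x_R − x_L in x and L₂ = y_R − y_L in y, and satisfy the sine-Gordon equation ∂ₜₜu = ∂ₓₓu + ∂ᵧᵧu − sin(u) at every point. Set v = ∂ₜu and r = √(2 − cos u). Then there exist constants C > 0 and τ₀ > 0, depending only on u and T, with the following property. For any positive integers N₁, N₂, M, set h₁ = L₁/N₁, h₂ = L₂/N₂, h = max(h₁,h₂), τ = T/M, and suppose τ ≤ τ₀. Define grid samples uⁿ(j₁,j₂) = u(x_L + j₁h₁, y_L + j₂h₂, nτ), and similarly vⁿ, rⁿ (these are (N₁,N₂)-periodic grid functions). Let the numerical solution (Uⁿ, Vⁿ, Rⁿ), n = 0,…,M, consist of (N₁,N₂)-periodic grid functions defined by: U⁰ = u⁰, V⁰ = v⁰, R⁰ = r⁰; for the first step (n = 0), (U¹,V¹,R¹) solves (U¹ − U⁰)/τ = (V¹+V⁰)/2, (V¹ − V⁰)/τ = δ_x²((U¹+U⁰)/2) + δ_y²((U¹+U⁰)/2)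 − b(U⁰)·(R¹+R⁰)/2, (R¹ − R⁰)/τ = (1/2)·b(U⁰)·(V¹+V⁰)/2 (b applied pointwise); and for 1 ≤ n ≤ M−1, (Uⁿ⁺¹,Vⁿ⁺¹,Rⁿ⁺¹) solves (Uⁿ⁺¹ − Uⁿ)/τ = (Vⁿ⁺¹+Vⁿ)/2, (Vⁿ⁺¹ − Vⁿ)/τ = δ_x²((Uⁿ⁺¹+Uⁿ)/2) + δ_y²((Uⁿ⁺¹+Uⁿ)/2) − b((3Uⁿ − Uⁿ⁻¹)/2)·(Rⁿ⁺¹+Rⁿ)/2, (Rⁿ⁺¹ − Rⁿ)/τ = (1/2)·b((3Uⁿ − Uⁿ⁻¹)/2)·(Vⁿ⁺¹+Vⁿ)/2. Then for every 0 ≤ n ≤ M: ‖uⁿ − Uⁿ‖_{H¹ₕ} + ‖vⁿ − Vⁿ‖ₕ + ‖rⁿ − Rⁿ‖ₕ ≤ C·(h² + τ²). -/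

import Mathlib

open Real

/-- Partial derivative in the first coordinate `x`. -/
noncomputable def px (u : ℝ × ℝ × ℝ → ℝ) : ℝ × ℝ × ℝ → ℝ :=
  fun p => deriv (fun s => u (s, p.2.1, p.2.2)) p.1

/-- Partial derivative in the second coordinate `y`. -/
noncomputable def py (u : ℝ × ℝ × ℝ → ℝ) : ℝ × ℝ × ℝ → ℝ :=
  fun p => deriv (fun s => u (p.1, s, p.2.2)) p.2.1

/-- Partial derivative in the third coordinate `t`. -/
noncomputable def pt (u : ℝ × ℝ × ℝ → ℝ) : ℝ × ℝ × ℝ → ℝ :=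
  fun p => deriv (fun s => u (p.1, p.2.1, s)) p.2.2

/-- The function `b(x) = sin x / √(2 - cos x)`. -/
noncomputable def b (x : ℝ) : ℝ := Real.sin x / Real.sqrt (2 - Real.cos x)

/-- Forward difference in the first index, with mesh size `h₁`. -/
noncomputable def dx (h₁ : ℝ) (W : ℤ × ℤ → ℝ) : ℤ × ℤ → ℝ :=
  fun j => (W (j.1 + 1, j.2) - W (j.1, j.2)) / h₁

/-- Forward difference in the second index, with mesh size `h₂`. -/
noncomputable def dy (h₂ : ℝ) (W : ℤ × ℤ → ℝ) : ℤ × ℤ → ℝ :=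
  fun j => (W (j.1, j.2 + 1) - W (j.1, j.2)) / h₂

/-- Second central difference in the first index, with mesh size `h₁`. -/
noncomputable def dxx (h₁ : ℝ) (W : ℤ × ℤ → ℝ) : ℤ × ℤ → ℝ :=
  fun j => (W (j.1 + 1, j.2) - 2 * W (j.1, j.2) + W (j.1 - 1, j.2)) / h₁ ^ 2

/-- Second central difference in the second index, with mesh size `h₂`. -/
noncomputable def dyy (h₂ : ℝ) (W : ℤ × ℤ → ℝ) : ℤ × ℤ → ℝ :=
  fun j => (W (j.1, j.2 + 1) - 2 * W (j.1, j.2) + W (j.1, j.2 - 1)) / h₂ ^ 2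

/-- An `(N₁,N₂)`-periodic grid function. -/
def GridPeriodic (N₁ N₂ : ℕ) (W : ℤ × ℤ → ℝ) : Prop :=
  ∀ j₁ j₂ : ℤ, W (j₁ + N₁, j₂) = W (j₁, j₂) ∧ W (j₁, j₂ + N₂) = W (j₁, j₂)

/-- Discrete inner product of grid functions over one period. -/
noncomputable def dInner (N₁ N₂ : ℕ) (h₁ h₂ : ℝ) (U V : ℤ × ℤ → ℝ) : ℝ :=
  h₁ * h₂ * ∑ j₁ ∈ Finset.range N₁, ∑ j₂ ∈ Finset.range N₂,
    U ((j₁ : ℤ), (j₂ : ℤ)) * V ((j₁ : ℤ), (j₂ : ℤ))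

/-- Discrete `L²` norm of a grid function over one period. -/
noncomputable def dNorm (N₁ N₂ : ℕ) (h₁ h₂ : ℝ) (U : ℤ × ℤ → ℝ) : ℝ :=
  Real.sqrt (dInner N₁ N₂ h₁ h₂ U U)

/-- Discrete `H¹` norm of a grid function over one period. -/
noncomputable def dH1Norm (N₁ N₂ : ℕ) (h₁ h₂ : ℝ) (U : ℤ × ℤ → ℝ) : ℝ :=
  Real.sqrt ((dNorm N₁ N₂ h₁ h₂ U)^2 + (dNorm N₁ N₂ h₁ h₂ (dx h₁ U))^2
    + (dNorm N₁ N₂ h₁ h₂ (dy h₂ U))^2)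


/-- Basic mean value step: a function vanishing at `0` with derivative bounded by `B`. -/
lemma mv_zero (F F' : ℝ → ℝ) (τ B : ℝ) (h0 : F 0 = 0)
    (hd : ∀ s, HasDerivAt F (F' s) s) (hB : ∀ s, 0 ≤ s → s ≤ τ → |F' s| ≤ B) :
    ∀ s, 0 ≤ s → s ≤ τ → |F s| ≤ B * s := by
  intro s hs0 hs1
  have := (convex_Icc (0:ℝ) s).norm_image_sub_le_of_norm_hasDerivWithin_le
    (f := F) (f' := F') (C := B) (x := 0) (y := s)
    (fun x _ => (hd x).hasDerivWithinAt)
    (fun x hx => by rw [Real.norm_eq_abs]; exact hB x hx.1 (hx.2.trans hs1))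
    ⟨le_refl _, hs0⟩ ⟨hs0, le_refl _⟩
  simpa [h0, abs_of_nonneg hs0] using this

lemma mv_zero' (F F' : ℝ → ℝ) (τ B : ℝ) (hB0 : 0 ≤ B) (h0 : F 0 = 0)
    (hd : ∀ s, HasDerivAt F (F' s) s) (hB : ∀ s, 0 ≤ s → s ≤ τ → |F' s| ≤ B) :
    ∀ s, 0 ≤ s → s ≤ τ → |F s| ≤ B * τ := by
  intro s hs0 hs1
  exact (mv_zero F F' τ B h0 hd hB s hs0 hs1).trans (by gcongr)

/-- Lipschitz bound. -/
lemma mv_lip (φ φ1 : ℝ → ℝ) (t τ A : ℝ) (hτ : 0 ≤ τ)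
    (h1 : ∀ s, HasDerivAt φ (φ1 s) s)
    (hA : ∀ s, t ≤ s → s ≤ t + τ → |φ1 s| ≤ A) :
    |φ (t + τ) - φ t| ≤ A * τ := by
  refine mv_zero (fun s => φ (t + s) - φ t) (fun s => φ1 (t + s)) τ A (by simp) ?_ ?_ τ hτ le_rfl
  · intro s
    exact ((h1 (t + s)).comp_const_add t s).sub_const _
  · intro s h0 h1
    exact hA _ (by linarith) (by linarith)

/-- Trapezoidal rule. -/
lemma trapezoid (φ φ1 φ2 φ3 : ℝ → ℝ) (t τ A : ℝ) (hτ : 0 ≤ τ)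
    (h1 : ∀ s, HasDerivAt φ (φ1 s) s) (h2 : ∀ s, HasDerivAt φ1 (φ2 s) s)
    (h3 : ∀ s, HasDerivAt φ2 (φ3 s) s)
    (hA : ∀ s, t ≤ s → s ≤ t + τ → |φ3 s| ≤ A) :
    |φ (t + τ) - φ t - τ * ((φ1 (t + τ) + φ1 t) / 2)| ≤ A * τ ^ 3 := by
  have hA0 : 0 ≤ A := (abs_nonneg _).trans (hA t le_rfl (by linarith))
  have c1 : ∀ s, HasDerivAt (fun s => φ (t + s)) (φ1 (t + s)) s :=
    fun s => (h1 (t + s)).comp_const_add t s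
  have c2 : ∀ s, HasDerivAt (fun s => φ1 (t + s)) (φ2 (t + s)) s :=
    fun s => (h2 (t + s)).comp_const_add t s
  have c3 : ∀ s, HasDerivAt (fun s => φ2 (t + s)) (φ3 (t + s)) s :=
    fun s => (h3 (t + s)).comp_const_add t s
  have k1 : ∀ s, 0 ≤ s → s ≤ τ →
      |φ1 (t + s) - (φ1 (t + s) + φ1 t) / 2 - s * (φ2 (t + s) / 2)| ≤ (A * τ) * τ := by
    refine mv_zero' (fun s => φ1 (t + s) - (φ1 (t + s) + φ1 t) / 2 - s * (φ2 (t + s) / 2))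
      (fun s => φ2 (t + s) - (φ2 (t + s)) / 2 - (1 * (φ2 (t + s) / 2) + s * (φ3 (t + s) / 2)))
      τ (A * τ) (by positivity) (by simp) ?_ ?_
    · intro s
      exact ((c2 s).sub (((c2 s).add_const _).div_const 2)).sub
        ((hasDerivAt_id s).mul ((c3 s).div_const 2))
    · intro s hs0 hs1
      have := hA (t + s) (by linarith) (by linarith)
      have e : φ2 (t + s) - (φ2 (t + s)) / 2 - (1 * (φ2 (t + s) / 2) + s * (φ3 (t + s) / 2))
        = - (φ3 (t + s) * (s / 2)) := by ring
      rw [e, abs_neg, abs_mul, abs_of_nonneg (by linarith : 0 ≤ s / 2)]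
      exact mul_le_mul this (by linarith) (by linarith) hA0
  have k2 := mv_zero' (fun s => φ (t + s) - φ t - s * ((φ1 (t + s) + φ1 t) / 2))
      (fun s => φ1 (t + s) - (1 * ((φ1 (t + s) + φ1 t) / 2) + s * (φ2 (t + s) / 2)))
      τ (A * τ * τ) (by positivity) (by simp)
      (fun s => ((c1 s).sub_const _).sub
        ((hasDerivAt_id s).mul (((c2 s).add_const _).div_const 2)))
      (fun s hs0 hs1 => by
        have := k1 s hs0 hs1
        convert this using 2
        ring) τ hτ le_rfl
  calc _ ≤ _ := k2
    _ = _ := by ring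

/-- Second difference, crude bound. -/
lemma second_diff (φ φ1 φ2 : ℝ → ℝ) (t τ A : ℝ) (hτ : 0 ≤ τ)
    (h1 : ∀ s, HasDerivAt φ (φ1 s) s) (h2 : ∀ s, HasDerivAt φ1 (φ2 s) s)
    (hA : ∀ s, t - τ ≤ s → s ≤ t + τ → |φ2 s| ≤ A) :
    |φ (t + τ) - 2 * φ t + φ (t - τ)| ≤ 2 * A * τ ^ 2 := by
  have hA0 : 0 ≤ A := (abs_nonneg _).trans (hA t (by linarith) (by linarith))
  have c1 : ∀ s, HasDerivAt (fun s => φ (t + s)) (φ1 (t + s)) s :=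
    fun s => (h1 (t + s)).comp_const_add t s
  have c2 : ∀ s, HasDerivAt (fun s => φ1 (t + s)) (φ2 (t + s)) s :=
    fun s => (h2 (t + s)).comp_const_add t s
  have d1 : ∀ s, HasDerivAt (fun s => φ (t - s)) (-φ1 (t - s)) s :=
    fun s => (h1 (t - s)).comp_const_sub t s
  have d2 : ∀ s, HasDerivAt (fun s => φ1 (t - s)) (-φ2 (t - s)) s :=
    fun s => (h2 (t - s)).comp_const_sub t s
  have k1 := mv_zero' (fun s => φ1 (t + s) - φ1 (t - s))
    (fun s => φ2 (t + s) - - φ2 (t - s)) τ (2 * A) (by positivity) (by simp)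
    (fun s => (c2 s).sub (d2 s)) (fun s hs0 hs1 => by
      have a1 := abs_le.1 (hA (t + s) (by linarith) (by linarith))
      have a2 := abs_le.1 (hA (t - s) (by linarith) (by linarith))
      rw [abs_le]; constructor <;> linarith)
  have k2 := mv_zero' (fun s => φ (t + s) - 2 * φ t + φ (t - s))
    (fun s => φ1 (t + s) + - φ1 (t - s)) τ (2 * A * τ) (by positivity) (by simp; ring)
    (fun s => ((c1 s).sub_const _).add (d1 s)) (fun s hs0 hs1 => k1 s hs0 hs1) τ hτ le_rfl
  calc _ ≤ _ := k2
    _ = _ := by ring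

/-- Second difference versus second derivative. -/
lemma second_diff' (φ φ1 φ2 φ3 φ4 : ℝ → ℝ) (t τ A : ℝ) (hτ : 0 ≤ τ)
    (h1 : ∀ s, HasDerivAt φ (φ1 s) s) (h2 : ∀ s, HasDerivAt φ1 (φ2 s) s)
    (h3 : ∀ s, HasDerivAt φ2 (φ3 s) s) (h4 : ∀ s, HasDerivAt φ3 (φ4 s) s)
    (hA : ∀ s, t - τ ≤ s → s ≤ t + τ → |φ4 s| ≤ A) :
    |φ (t + τ) - 2 * φ t + φ (t - τ) - τ ^ 2 * φ2 t| ≤ 2 * A * τ ^ 4 := by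
  have hA0 : 0 ≤ A := (abs_nonneg _).trans (hA t (by linarith) (by linarith))
  have c1 : ∀ s, HasDerivAt (fun s => φ (t + s)) (φ1 (t + s)) s :=
    fun s => (h1 (t + s)).comp_const_add t s
  have c2 : ∀ s, HasDerivAt (fun s => φ1 (t + s)) (φ2 (t + s)) s :=
    fun s => (h2 (t + s)).comp_const_add t s
  have d1 : ∀ s, HasDerivAt (fun s => φ (t - s)) (-φ1 (t - s)) s :=
    fun s => (h1 (t - s)).comp_const_sub t s
  have d2 : ∀ s, HasDerivAt (fun s => φ1 (t - s)) (-φ2 (t - s)) s :=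
    fun s => (h2 (t - s)).comp_const_sub t s
  have k0 : ∀ s, 0 ≤ s → s ≤ τ → |φ2 (t + s) - 2 * φ2 t + φ2 (t - s)| ≤ 2 * A * τ ^ 2 := by
    intro s hs0 hs1
    refine (second_diff φ2 φ3 φ4 t s A hs0 h3 h4
      (fun s' a b => hA s' (by linarith) (by linarith))).trans (by gcongr)
  have k1 := mv_zero' (fun s => φ1 (t + s) - φ1 (t - s) - s * (2 * φ2 t))
    (fun s => φ2 (t + s) - - φ2 (t - s) - 1 * (2 * φ2 t)) τ (2 * A * τ ^ 2)
    (by positivity) (by simp)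
    (fun s => ((c2 s).sub (d2 s)).sub ((hasDerivAt_id s).mul_const _)) (fun s hs0 hs1 => by
      convert k0 s hs0 hs1 using 2; ring)
  have k2 := mv_zero' (fun s => φ (t + s) - 2 * φ t + φ (t - s) - s ^ 2 * φ2 t)
    (fun s => φ1 (t + s) + - φ1 (t - s) - (((2:ℕ):ℝ) * s ^ (2 - 1)) * φ2 t)
    τ (2 * A * τ ^ 2 * τ) (by positivity) (by simp; ring)
    (fun s => (((c1 s).sub_const _).add (d1 s)).sub ((hasDerivAt_pow 2 s).mul_const _))
    (fun s hs0 hs1 => by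
      convert k1 s hs0 hs1 using 2; norm_num; ring) τ hτ le_rfl
  calc _ ≤ _ := k2
    _ = _ := by ring

/-! ### Partial derivatives -/

lemma px_hasDerivAt {u : ℝ × ℝ × ℝ → ℝ} (hu : ContDiff ℝ 1 u) (x y t : ℝ) :
    HasDerivAt (fun s => u (s, y, t)) (px u (x, y, t)) x := by
  have hd : Differentiable ℝ (fun s : ℝ => u (s, y, t)) :=
    (hu.differentiable (by norm_num)).comp (by fun_prop)
  exact (hd x).hasDerivAt

lemma py_hasDerivAt {u : ℝ × ℝ × ℝ → ℝ} (hu : ContDiff ℝ 1 u) (x y t : ℝ) :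
    HasDerivAt (fun s => u (x, s, t)) (py u (x, y, t)) y := by
  have hd : Differentiable ℝ (fun s : ℝ => u (x, s, t)) :=
    (hu.differentiable (by norm_num)).comp (by fun_prop)
  exact (hd y).hasDerivAt

lemma pt_hasDerivAt {u : ℝ × ℝ × ℝ → ℝ} (hu : ContDiff ℝ 1 u) (x y t : ℝ) :
    HasDerivAt (fun s => u (x, y, s)) (pt u (x, y, t)) t := by
  have hd : Differentiable ℝ (fun s : ℝ => u (x, y, s)) :=
    (hu.differentiable (by norm_num)).comp (by fun_prop)
  exact (hd t).hasDerivAt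

lemma px_eq {u : ℝ × ℝ × ℝ → ℝ} (hu : ContDiff ℝ 1 u) :
    px u = fun p => fderiv ℝ u p (1, 0, 0) := by
  funext p
  obtain ⟨x, y, t⟩ := p
  have h1 := ((hu.differentiable (by norm_num)) (x, y, t)).hasFDerivAt
  have h2 : HasDerivAt (fun s : ℝ => (s, y, t)) ((1:ℝ), (0:ℝ), (0:ℝ)) x :=
    (hasDerivAt_id x).prodMk ((hasDerivAt_const x y).prodMk (hasDerivAt_const x t))
  exact (px_hasDerivAt hu x y t).unique (h1.comp_hasDerivAt x h2)

lemma py_eq {u : ℝ × ℝ × ℝ → ℝ} (hu : ContDiff ℝ 1 u) :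
    py u = fun p => fderiv ℝ u p (0, 1, 0) := by
  funext p
  obtain ⟨x, y, t⟩ := p
  have h1 := ((hu.differentiable (by norm_num)) (x, y, t)).hasFDerivAt
  have h2 : HasDerivAt (fun s : ℝ => (x, s, t)) ((0:ℝ), (1:ℝ), (0:ℝ)) y :=
    (hasDerivAt_const y x).prodMk ((hasDerivAt_id y).prodMk (hasDerivAt_const y t))
  exact (py_hasDerivAt hu x y t).unique (h1.comp_hasDerivAt y h2)

lemma pt_eq {u : ℝ × ℝ × ℝ → ℝ} (hu : ContDiff ℝ 1 u) :
    pt u = fun p => fderiv ℝ u p (0, 0, 1) := by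
  funext p
  obtain ⟨x, y, t⟩ := p
  have h1 := ((hu.differentiable (by norm_num)) (x, y, t)).hasFDerivAt
  have h2 : HasDerivAt (fun s : ℝ => (x, y, s)) ((0:ℝ), (0:ℝ), (1:ℝ)) t :=
    (hasDerivAt_const t x).prodMk ((hasDerivAt_const t y).prodMk (hasDerivAt_id t))
  exact (pt_hasDerivAt hu x y t).unique (h1.comp_hasDerivAt t h2)

lemma px_contDiff {u : ℝ × ℝ × ℝ → ℝ} (n : ℕ) (hu : ContDiff ℝ ((n + 1 : ℕ) : ℕ∞) u) :
    ContDiff ℝ (n : ℕ∞) (px u) := by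
  rw [px_eq (hu.of_le (by exact_mod_cast Nat.le_add_left 1 n))]
  exact (hu.fderiv_right (by norm_cast)).clm_apply contDiff_const

lemma py_contDiff {u : ℝ × ℝ × ℝ → ℝ} (n : ℕ) (hu : ContDiff ℝ ((n + 1 : ℕ) : ℕ∞) u) :
    ContDiff ℝ (n : ℕ∞) (py u) := by
  rw [py_eq (hu.of_le (by exact_mod_cast Nat.le_add_left 1 n))]
  exact (hu.fderiv_right (by norm_cast)).clm_apply contDiff_const

lemma pt_contDiff {u : ℝ × ℝ × ℝ → ℝ} (n : ℕ) (hu : ContDiff ℝ ((n + 1 : ℕ) : ℕ∞) u) :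
    ContDiff ℝ (n : ℕ∞) (pt u) := by
  rw [pt_eq (hu.of_le (by exact_mod_cast Nat.le_add_left 1 n))]
  exact (hu.fderiv_right (by norm_cast)).clm_apply contDiff_const

/-! ### The function `b` -/

lemma two_sub_cos_ge (x : ℝ) : 1 ≤ 2 - Real.cos x := by linarith [Real.cos_le_one x]

lemma sqrt_ge_one (x : ℝ) : 1 ≤ Real.sqrt (2 - Real.cos x) := by
  rw [Real.one_le_sqrt]; exact two_sub_cos_ge x

lemma sqrt_le_two (x : ℝ) : Real.sqrt (2 - Real.cos x) ≤ 2 := by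
  rw [Real.sqrt_le_left (by norm_num)]; linarith [Real.neg_one_le_cos x]

lemma b_abs_le (x : ℝ) : |b x| ≤ 1 := by
  unfold b
  have := sqrt_ge_one x
  rw [abs_div, abs_of_nonneg (by linarith : 0 ≤ Real.sqrt (2 - Real.cos x)),
    div_le_one (by linarith)]
  exact (Real.abs_sin_le_one x).trans this

lemma b_mul_sqrt (x : ℝ) : b x * Real.sqrt (2 - Real.cos x) = Real.sin x := by
  unfold b
  have := sqrt_ge_one x
  field_simp

lemma rho_contDiff (n : WithTop ℕ∞) : ContDiff ℝ n (fun x : ℝ => Real.sqrt (2 - Real.cos x)) := by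
  refine ContDiff.sqrt (contDiff_const.sub Real.contDiff_cos) (fun x => ?_)
  linarith [two_sub_cos_ge x]

lemma b_contDiff (n : WithTop ℕ∞) : ContDiff ℝ n b := by
  unfold b
  refine Real.contDiff_sin.div (rho_contDiff n) (fun x => ?_)
  linarith [sqrt_ge_one x]

lemma rho_hasDerivAt (x : ℝ) :
    HasDerivAt (fun x : ℝ => Real.sqrt (2 - Real.cos x)) (1 / 2 * b x) x := by
  have h := ((Real.hasDerivAt_cos x).const_sub 2).sqrt (by linarith [two_sub_cos_ge x])
  convert h using 1
  unfold b
  have := sqrt_ge_one x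
  field_simp

lemma b_periodic : Function.Periodic b (2 * π) := by
  intro x; simp [b]

lemma deriv_periodic {f : ℝ → ℝ} {c : ℝ} (hf : Function.Periodic f c) :
    Function.Periodic (deriv f) c := by
  intro x
  rw [← deriv_comp_add_const]
  congr 1
  funext y
  exact hf y

lemma periodic_bdd {f : ℝ → ℝ} (hf : Function.Periodic f (2 * π)) (hc : Continuous f) :
    ∃ B, ∀ x, |f x| ≤ B := by
  have := hf.isBounded_of_continuous (by positivity) hc
  obtain ⟨B, hB⟩ := this.exists_norm_le
  exact ⟨B, fun x => hB _ ⟨x, rfl⟩⟩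

lemma b_consts : ∃ B : ℝ, 1 ≤ B ∧ (∀ x y, |b x - b y| ≤ B * |x - y|) ∧
    (∀ x y, |(b x + b y) / 2 - b ((x + y) / 2)| ≤ B * (x - y) ^ 2) := by
  have hb1 : ContDiff ℝ 1 (deriv b) := by
    have := b_contDiff 2
    rw [show (2 : WithTop ℕ∞) = 1 + 1 by norm_num, contDiff_succ_iff_deriv] at this
    exact this.2.2
  have hb2 : Continuous (deriv (deriv b)) := hb1.continuous_deriv (by norm_num)
  obtain ⟨B1, h1⟩ := periodic_bdd (deriv_periodic b_periodic) hb1.continuous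
  obtain ⟨B2, h2⟩ := periodic_bdd (deriv_periodic (deriv_periodic b_periodic)) hb2
  have hd1 : ∀ s, HasDerivAt b (deriv b s) s := fun s =>
    (((b_contDiff 1).differentiable (by norm_num)) s).hasDerivAt
  have hd2 : ∀ s, HasDerivAt (deriv b) (deriv (deriv b) s) s := fun s =>
    ((hb1.differentiable (by norm_num)) s).hasDerivAt
  have l1 : ∀ x y, x ≤ y → |b y - b x| ≤ B1 * (y - x) := by
    intro x y hxy
    have := mv_lip b (deriv b) x (y - x) B1 (by linarith) hd1 (fun s _ _ => h1 s)
    rwa [add_sub_cancel] at this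
  have l2 : ∀ x y, x ≤ y → |(b x + b y) / 2 - b ((x + y) / 2)| ≤ B2 * (x - y) ^ 2 := by
    intro x y hxy
    have := second_diff b (deriv b) (deriv (deriv b)) ((x + y) / 2) ((y - x) / 2) B2
      (by linarith) hd1 hd2 (fun s _ _ => h2 s)
    rw [show (x + y) / 2 + (y - x) / 2 = y by ring,
      show (x + y) / 2 - (y - x) / 2 = x by ring] at this
    have hB2 : 0 ≤ B2 := (abs_nonneg _).trans (h2 0)
    rw [abs_le] at this ⊢
    have : 0 ≤ B2 * (x - y) ^ 2 := by positivity
    constructor <;> nlinarith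
  have hB1 : 0 ≤ B1 := (abs_nonneg _).trans (h1 0)
  have hB2 : 0 ≤ B2 := (abs_nonneg _).trans (h2 0)
  refine ⟨1 + B1 + B2, by linarith, ?_, ?_⟩
  · intro x y
    rcases le_total x y with h | h
    · rw [abs_sub_comm, abs_sub_comm x y, abs_of_nonneg (by linarith : 0 ≤ y - x)]
      exact (l1 x y h).trans (by nlinarith)
    · rw [abs_of_nonneg (by linarith : 0 ≤ x - y)]
      exact (l1 y x h).trans (by nlinarith)
  · intro x y
    rcases le_total x y with h | h
    · exact (l2 x y h).trans (by nlinarith [sq_nonneg (x - y)])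
    · have := l2 y x h
      rw [add_comm (b y), add_comm y x] at this
      exact this.trans (by nlinarith [sq_nonneg (x - y)])


/-! ### Truncation errors -/

lemma trap_div (φ φ1 φ2 φ3 : ℝ → ℝ) (t τ A : ℝ) (hτ : 0 < τ)
    (h1 : ∀ s, HasDerivAt φ (φ1 s) s) (h2 : ∀ s, HasDerivAt φ1 (φ2 s) s)
    (h3 : ∀ s, HasDerivAt φ2 (φ3 s) s)
    (hA : ∀ s, t ≤ s → s ≤ t + τ → |φ3 s| ≤ A) :
    |(φ (t + τ) - φ t) / τ - (φ1 (t + τ) + φ1 t) / 2| ≤ A * τ ^ 2 := by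
  have h := trapezoid φ φ1 φ2 φ3 t τ A hτ.le h1 h2 h3 hA
  have e : (φ (t + τ) - φ t) / τ - (φ1 (t + τ) + φ1 t) / 2
      = (φ (t + τ) - φ t - τ * ((φ1 (t + τ) + φ1 t) / 2)) / τ := by field_simp
  rw [e, abs_div, abs_of_pos hτ, div_le_iff₀ hτ]
  calc _ ≤ _ := h
    _ = _ := by ring

lemma sd_div (φ φ1 φ2 φ3 φ4 : ℝ → ℝ) (t τ A : ℝ) (hτ : 0 < τ)
    (h1 : ∀ s, HasDerivAt φ (φ1 s) s) (h2 : ∀ s, HasDerivAt φ1 (φ2 s) s)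
    (h3 : ∀ s, HasDerivAt φ2 (φ3 s) s) (h4 : ∀ s, HasDerivAt φ3 (φ4 s) s)
    (hA : ∀ s, t - τ ≤ s → s ≤ t + τ → |φ4 s| ≤ A) :
    |(φ (t + τ) - 2 * φ t + φ (t - τ)) / τ ^ 2 - φ2 t| ≤ 2 * A * τ ^ 2 := by
  have h := second_diff' φ φ1 φ2 φ3 φ4 t τ A hτ.le h1 h2 h3 h4 hA
  have e : (φ (t + τ) - 2 * φ t + φ (t - τ)) / τ ^ 2 - φ2 t
      = (φ (t + τ) - 2 * φ t + φ (t - τ) - τ ^ 2 * φ2 t) / τ ^ 2 := by field_simp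
  have h2 : 0 < τ ^ 2 := by positivity
  rw [e, abs_div, abs_of_pos h2, div_le_iff₀ h2]
  calc _ ≤ _ := h
    _ = _ := by ring

lemma box_bdd {F : ℝ × ℝ × ℝ → ℝ} (hF : Continuous F) (a1 a2 b1 b2 c1 c2 : ℝ) :
    ∃ A, 0 ≤ A ∧ ∀ x y t, a1 ≤ x → x ≤ a2 → b1 ≤ y → y ≤ b2 → c1 ≤ t → t ≤ c2 →
      |F (x, y, t)| ≤ A := by
  obtain ⟨A, hA⟩ := (isCompact_Icc (a := (a1, b1, c1)) (b := (a2, b2, c2))).exists_bound_of_continuousOn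
    hF.continuousOn
  refine ⟨max A 0, le_max_right _ _, fun x y t h1 h2 h3 h4 h5 h6 => ?_⟩
  exact (hA (x, y, t) ⟨⟨h1, h3, h5⟩, ⟨h2, h4, h6⟩⟩).trans (le_max_left _ _)

lemma prod_avg (β β' βh r r' P Q τ : ℝ) (hP : 0 ≤ P) (hτ : 0 ≤ τ) (h1 : |β' - β| ≤ P * τ)
    (h2 : |r' - r| ≤ P * τ) (h3 : |(β + β') / 2 - βh| ≤ Q) (h4 : |r| ≤ P) (h5 : |r'| ≤ P) :
    |(β' * r' + β * r) / 2 - βh * ((r' + r) / 2)| ≤ P ^ 2 * τ ^ 2 + Q * P := by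
  have e : (β' * r' + β * r) / 2 - βh * ((r' + r) / 2)
    = 1 / 4 * ((β' - β) * (r' - r)) + ((β + β') / 2 - βh) * ((r' + r) / 2) := by ring
  have m1 : |(β' - β) * (r' - r)| ≤ (P * τ) * (P * τ) := by
    rw [abs_mul]; exact mul_le_mul h1 h2 (abs_nonneg _) (by positivity)
  have hQ : 0 ≤ Q := (abs_nonneg _).trans h3
  have m2 : |((β + β') / 2 - βh) * ((r' + r) / 2)| ≤ Q * P := by
    rw [abs_mul]
    refine mul_le_mul h3 ?_ (abs_nonneg _) hQ
    rw [abs_le] at *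
    constructor <;> linarith
  rw [e]
  rw [abs_le] at *
  have : 0 ≤ P ^ 2 * τ ^ 2 := by positivity
  constructor <;> nlinarith

/-- Discrete Laplacian of the exact solution. -/
noncomputable def lapE (u : ℝ × ℝ × ℝ → ℝ) (h₁ h₂ x y t : ℝ) : ℝ :=
  (u (x + h₁, y, t) - 2 * u (x, y, t) + u (x - h₁, y, t)) / h₁ ^ 2
  + (u (x, y + h₂, t) - 2 * u (x, y, t) + u (x, y - h₂, t)) / h₂ ^ 2

noncomputable def rE (u : ℝ × ℝ × ℝ → ℝ) (p : ℝ × ℝ × ℝ) : ℝ := Real.sqrt (2 - Real.cos (u p))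

/-- All consistency bounds, at the point `(x,y)` and for the step from `t` to `t+τ`. -/
structure Consis (u : ℝ × ℝ × ℝ → ℝ) (A x y t τ h₁ h₂ : ℝ) : Prop where
  c1 : |(u (x, y, t + τ) - u (x, y, t)) / τ - (pt u (x, y, t + τ) + pt u (x, y, t)) / 2|
    ≤ A * τ ^ 2
  c2 : |((u (x + h₁, y, t + τ) - u (x, y, t + τ)) / h₁ - (u (x + h₁, y, t) - u (x, y, t)) / h₁) / τ
    - ((pt u (x + h₁, y, t + τ) - pt u (x, y, t + τ)) / h₁
      + (pt u (x + h₁, y, t) - pt u (x, y, t)) / h₁) / 2| ≤ A * τ ^ 2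
  c3 : |((u (x, y + h₂, t + τ) - u (x, y, t + τ)) / h₂ - (u (x, y + h₂, t) - u (x, y, t)) / h₂) / τ
    - ((pt u (x, y + h₂, t + τ) - pt u (x, y, t + τ)) / h₂
      + (pt u (x, y + h₂, t) - pt u (x, y, t)) / h₂) / 2| ≤ A * τ ^ 2
  c4 : ∀ uh d, |uh - (u (x, y, t + τ) + u (x, y, t)) / 2| ≤ d →
    |(pt u (x, y, t + τ) - pt u (x, y, t)) / τ
      - (lapE u h₁ h₂ x y (t + τ) + lapE u h₁ h₂ x y t) / 2
      + b uh * ((rE u (x, y, t + τ) + rE u (x, y, t)) / 2)| ≤ A * (τ ^ 2 + h₁ ^ 2 + h₂ ^ 2 + d)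
  c5 : ∀ uh d, |uh - (u (x, y, t + τ) + u (x, y, t)) / 2| ≤ d →
    |(rE u (x, y, t + τ) - rE u (x, y, t)) / τ
      - 1 / 2 * b uh * ((pt u (x, y, t + τ) + pt u (x, y, t)) / 2)| ≤ A * (τ ^ 2 + d)
  c6 : |pt u (x, y, t)| ≤ A
  c6' : |pt u (x, y, t + τ)| ≤ A
  c7 : |u (x, y, t + τ) - u (x, y, t)| ≤ A * τ
  c8 : 0 ≤ t - τ → |u (x, y, t + τ) - 2 * u (x, y, t) + u (x, y, t - τ)| ≤ A * τ ^ 2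

set_option maxHeartbeats 4000000 in
lemma trunc (xL xR yL yR T : ℝ) (hx : xL < xR) (hy : yL < yR)
    (u : ℝ × ℝ × ℝ → ℝ) (hu : ContDiff ℝ 4 u)
    (hSG : ∀ p : ℝ × ℝ × ℝ,
      pt (pt u) p = px (px u) p + py (py u) p - Real.sin (u p)) :
    ∃ A, 1 ≤ A ∧ ∀ x y t τ h₁ h₂, xL ≤ x → x ≤ xR → yL ≤ y → y ≤ yR → 0 ≤ t → 0 < τ →
      t + τ ≤ T → 0 < h₁ → h₁ ≤ xR - xL → 0 < h₂ → h₂ ≤ yR - yL → 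
      Consis u A x y t τ h₁ h₂ := by
  have hu4 : ContDiff ℝ ((4 : ℕ) : ℕ∞) u := by exact_mod_cast hu
  have t1 := pt_contDiff 3 hu4
  have t2 := pt_contDiff 2 t1
  have t3 := pt_contDiff 1 t2
  have t4 := pt_contDiff 0 t3
  have x1 := px_contDiff 3 hu4
  have x2 := px_contDiff 2 x1
  have x3 := px_contDiff 1 x2
  have x4 := px_contDiff 0 x3
  have y1 := py_contDiff 3 hu4
  have y2 := py_contDiff 2 y1
  have y3 := py_contDiff 1 y2
  have y4 := py_contDiff 0 y3
  have t3x := px_contDiff 0 t3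
  have t3y := py_contDiff 0 t3
  have hr : ContDiff ℝ ((4 : ℕ) : ℕ∞) (rE u) := (rho_contDiff _).comp hu4
  have r1 := pt_contDiff 3 hr
  have r2 := pt_contDiff 2 r1
  have r3 := pt_contDiff 1 r2
  have w1 : ∀ {F : ℝ × ℝ × ℝ → ℝ} (n : ℕ), ContDiff ℝ ((n + 1 : ℕ) : ℕ∞) F → ContDiff ℝ 1 F :=
    fun n h => h.of_le (by exact_mod_cast Nat.le_add_left 1 n)
  have ptr : ∀ x y t, pt (rE u) (x, y, t) = 1 / 2 * (b (u (x, y, t)) * pt u (x, y, t)) := by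
    intro x y t
    have h := (rho_hasDerivAt (u (x, y, t))).comp t (pt_hasDerivAt (w1 3 hu4) x y t)
    rw [(pt_hasDerivAt (w1 3 hr) x y t).unique h]; ring
  obtain ⟨B, hB1, hBl, hBs⟩ := b_consts
  have bd := fun {F : ℝ × ℝ × ℝ → ℝ} (hF : Continuous F) =>
    box_bdd hF (xL - (xR - xL)) (xR + (xR - xL)) (yL - (yR - yL)) (yR + (yR - yL)) 0 T
  obtain ⟨A1, p1, q1⟩ := bd t1.continuous
  obtain ⟨A2, p2, q2⟩ := bd t2.continuous
  obtain ⟨A3, p3, q3⟩ := bd t3.continuous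
  obtain ⟨A4, p4, q4⟩ := bd t4.continuous
  obtain ⟨A5, p5, q5⟩ := bd x4.continuous
  obtain ⟨A6, p6, q6⟩ := bd y4.continuous
  obtain ⟨A7, p7, q7⟩ := bd t3x.continuous
  obtain ⟨A8, p8, q8⟩ := bd t3y.continuous
  obtain ⟨A9, p9, q9⟩ := bd r1.continuous
  obtain ⟨A10, p10, q10⟩ := bd r3.continuous
  obtain ⟨A0, hA0⟩ : ∃ A0, A0 = 2 + A1 + A2 + A3 + A4 + A5 + A6 + A7 + A8 + A9 + A10 := ⟨_, rfl⟩
  have hA0' : 2 ≤ A0 := by linarith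
  have hBA : A0 ≤ B * A0 := by nlinarith
  have P1 : 0 ≤ (B * A0) ^ 2 := by positivity
  have P2 : 0 ≤ B * A0 ^ 2 * (B * A0) := by positivity
  have P3 : 0 ≤ B * (B * A0) := by positivity
  refine ⟨4 * A0 + (B * A0) ^ 2 + B * A0 ^ 2 * (B * A0) + B * (B * A0), by linarith, ?_⟩
  intro x y t τ h₁ h₂ hx1 hx2 hy1 hy2 ht hτ htT hh1 hh1' hh2 hh2'
  obtain ⟨A, hA⟩ : ∃ A, A = 4 * A0 + (B * A0) ^ 2 + B * A0 ^ 2 * (B * A0) + B * (B * A0) :=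
    ⟨_, rfl⟩
  rw [← hA]
  have hAA : 4 * A0 ≤ A := by linarith
  have τ2 : 0 < τ ^ 2 := by positivity
  have du := fun s => pt_hasDerivAt (w1 3 hu4) x y s
  have dv := fun s => pt_hasDerivAt (w1 2 t1) x y s
  have dw := fun s => pt_hasDerivAt (w1 1 t2) x y s
  have dz := fun s => pt_hasDerivAt (w1 0 t3) x y s
  have c6g : ∀ s, 0 ≤ s → s ≤ T → |pt u (x, y, s)| ≤ A0 := fun s hs0 hs1 =>
    (q1 x y s (by linarith) (by linarith) (by linarith) (by linarith) hs0 hs1).trans (by linarith)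
  have c7g : |u (x, y, t + τ) - u (x, y, t)| ≤ A0 * τ :=
    mv_lip (fun s => u (x, y, s)) _ t τ A0 hτ.le du
      (fun s hs0 hs1 => c6g s (by linarith) (by linarith))
  have v7g : |pt u (x, y, t + τ) - pt u (x, y, t)| ≤ A0 * τ :=
    mv_lip (fun s => pt u (x, y, s)) _ t τ A0 hτ.le dv
      (fun s hs0 hs1 => (q2 x y s (by linarith) (by linarith) (by linarith) (by linarith)
        (by linarith) (by linarith)).trans (by linarith))
  have r7g : |rE u (x, y, t + τ) - rE u (x, y, t)| ≤ A0 * τ :=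
    mv_lip (fun s => rE u (x, y, s)) _ t τ A0 hτ.le (fun s => pt_hasDerivAt (w1 3 hr) x y s)
      (fun s hs0 hs1 => (q9 x y s (by linarith) (by linarith) (by linarith) (by linarith)
        (by linarith) (by linarith)).trans (by linarith))
  have hrb : ∀ p, |rE u p| ≤ A0 := fun p => by
    unfold rE
    rw [abs_of_nonneg (Real.sqrt_nonneg _)]
    exact (sqrt_le_two _).trans hA0'
  have hb7 : |b (u (x, y, t + τ)) - b (u (x, y, t))| ≤ B * A0 * τ :=
    (hBl _ _).trans (by rw [mul_assoc]; exact mul_le_mul_of_nonneg_left c7g (by linarith))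
  have hQ : ∀ uh d, |uh - (u (x, y, t + τ) + u (x, y, t)) / 2| ≤ d →
      |(b (u (x, y, t)) + b (u (x, y, t + τ))) / 2 - b uh| ≤ B * d + B * A0 ^ 2 * τ ^ 2 := by
    intro uh d hd
    have e1 := hBs (u (x, y, t)) (u (x, y, t + τ))
    have e2 := hBl ((u (x, y, t) + u (x, y, t + τ)) / 2) uh
    have e3 : (u (x, y, t) - u (x, y, t + τ)) ^ 2 ≤ (A0 * τ) ^ 2 := by
      rw [← sq_abs, abs_sub_comm]
      exact pow_le_pow_left₀ (abs_nonneg _) c7g 2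
    have e4 : B * (u (x, y, t) - u (x, y, t + τ)) ^ 2 ≤ B * (A0 * τ) ^ 2 :=
      mul_le_mul_of_nonneg_left e3 (by linarith)
    have e5 : B * |(u (x, y, t) + u (x, y, t + τ)) / 2 - uh| ≤ B * d := by
      refine mul_le_mul_of_nonneg_left ?_ (by linarith)
      rw [abs_sub_comm, add_comm (u (x, y, t))]; exact hd
    have e6 := e1.trans e4
    have e7 := e2.trans e5
    rw [abs_le] at e6 e7 ⊢
    constructor <;> linarith
  have hA0τ : A0 * τ ≤ B * A0 * τ := mul_le_mul_of_nonneg_right hBA hτ.le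
  constructor
  · refine (trap_div (fun s => u (x, y, s)) _ _ _ t τ A0 hτ du dv dw ?_).trans
      (mul_le_mul_of_nonneg_right (by linarith) τ2.le)
    intro s hs0 hs1
    exact (q3 x y s (by linarith) (by linarith) (by linarith) (by linarith)
        (by linarith) (by linarith)).trans (by linarith)
  · refine (trap_div (fun s => (u (x + h₁, y, s) - u (x, y, s)) / h₁)
      (fun s => (pt u (x + h₁, y, s) - pt u (x, y, s)) / h₁)
      (fun s => (pt (pt u) (x + h₁, y, s) - pt (pt u) (x, y, s)) / h₁)
      (fun s => (pt (pt (pt u)) (x + h₁, y, s) - pt (pt (pt u)) (x, y, s)) / h₁) t τ A0 hτ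
      (fun s => ((pt_hasDerivAt (w1 3 hu4) (x + h₁) y s).sub (du s)).div_const _)
      (fun s => ((pt_hasDerivAt (w1 2 t1) (x + h₁) y s).sub (dv s)).div_const _)
      (fun s => ((pt_hasDerivAt (w1 1 t2) (x + h₁) y s).sub (dw s)).div_const _) ?_).trans
      (mul_le_mul_of_nonneg_right (by linarith) τ2.le)
    intro s hs0 hs1
    rw [abs_div, abs_of_pos hh1, div_le_iff₀ hh1]
    refine mv_lip (fun z => pt (pt (pt u)) (z, y, s)) _ x h₁ A0 hh1.le
      (fun z => px_hasDerivAt (w1 0 t3) z y s) ?_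
    intro z hz0 hz1
    exact (q7 z y s (by linarith) (by linarith) (by linarith) (by linarith)
        (by linarith) (by linarith)).trans (by linarith)
  · refine (trap_div (fun s => (u (x, y + h₂, s) - u (x, y, s)) / h₂)
      (fun s => (pt u (x, y + h₂, s) - pt u (x, y, s)) / h₂)
      (fun s => (pt (pt u) (x, y + h₂, s) - pt (pt u) (x, y, s)) / h₂)
      (fun s => (pt (pt (pt u)) (x, y + h₂, s) - pt (pt (pt u)) (x, y, s)) / h₂) t τ A0 hτ
      (fun s => ((pt_hasDerivAt (w1 3 hu4) x (y + h₂) s).sub (du s)).div_const _)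
      (fun s => ((pt_hasDerivAt (w1 2 t1) x (y + h₂) s).sub (dv s)).div_const _)
      (fun s => ((pt_hasDerivAt (w1 1 t2) x (y + h₂) s).sub (dw s)).div_const _) ?_).trans
      (mul_le_mul_of_nonneg_right (by linarith) τ2.le)
    intro s hs0 hs1
    rw [abs_div, abs_of_pos hh2, div_le_iff₀ hh2]
    refine mv_lip (fun z => pt (pt (pt u)) (x, z, s)) _ y h₂ A0 hh2.le
      (fun z => py_hasDerivAt (w1 0 t3) x z s) ?_
    intro z hz0 hz1
    exact (q8 x z s (by linarith) (by linarith) (by linarith) (by linarith)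
        (by linarith) (by linarith)).trans (by linarith)
  · intro uh d hd
    have hd0 : 0 ≤ d := (abs_nonneg _).trans hd
    have a1 := trap_div (fun s => pt u (x, y, s)) _ _ _ t τ A0 hτ dv dw dz
      (fun s hs0 hs1 => (q4 x y s (by linarith) (by linarith) (by linarith) (by linarith)
        (by linarith) (by linarith)).trans (by linarith))
    have a2 : ∀ s, 0 ≤ s → s ≤ T → |(u (x + h₁, y, s) - 2 * u (x, y, s) + u (x - h₁, y, s)) / h₁ ^ 2
        - px (px u) (x, y, s)| ≤ 2 * A0 * h₁ ^ 2 := fun s hs0 hs1 =>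
      sd_div (fun z => u (z, y, s)) _ _ _ _ x h₁ A0 hh1
        (fun z => px_hasDerivAt (w1 3 hu4) z y s) (fun z => px_hasDerivAt (w1 2 x1) z y s)
        (fun z => px_hasDerivAt (w1 1 x2) z y s) (fun z => px_hasDerivAt (w1 0 x3) z y s)
        (fun z hz0 hz1 => (q5 z y s (by linarith) (by linarith) (by linarith) (by linarith)
        (by linarith) (by linarith)).trans (by linarith))
    have a3 : ∀ s, 0 ≤ s → s ≤ T → |(u (x, y + h₂, s) - 2 * u (x, y, s) + u (x, y - h₂, s)) / h₂ ^ 2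
        - py (py u) (x, y, s)| ≤ 2 * A0 * h₂ ^ 2 := fun s hs0 hs1 =>
      sd_div (fun z => u (x, z, s)) _ _ _ _ y h₂ A0 hh2
        (fun z => py_hasDerivAt (w1 3 hu4) x z s) (fun z => py_hasDerivAt (w1 2 y1) x z s)
        (fun z => py_hasDerivAt (w1 1 y2) x z s) (fun z => py_hasDerivAt (w1 0 y3) x z s)
        (fun z hz0 hz1 => (q6 x z s (by linarith) (by linarith) (by linarith) (by linarith)
        (by linarith) (by linarith)).trans (by linarith))
    have a2a := a2 t ht (by linarith)
    have a2b := a2 (t + τ) (by linarith) htT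
    have a3a := a3 t ht (by linarith)
    have a3b := a3 (t + τ) (by linarith) htT
    have a4 := prod_avg (b (u (x, y, t))) (b (u (x, y, t + τ))) (b uh) (rE u (x, y, t))
      (rE u (x, y, t + τ)) (B * A0) _ τ (by positivity) hτ.le hb7 (r7g.trans hA0τ) (hQ uh d hd)
      ((hrb _).trans hBA) ((hrb _).trans hBA)
    have g1 := hSG (x, y, t)
    have g2 := hSG (x, y, t + τ)
    rw [← b_mul_sqrt] at g1 g2
    change _ = _ + _ - b (u (x, y, t)) * rE u (x, y, t) at g1
    change _ = _ + _ - b (u (x, y, t + τ)) * rE u (x, y, t + τ) at g2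
    rw [g1, g2] at a1
    have M1 : 0 ≤ ((B * A0) ^ 2 + B * A0 ^ 2 * (B * A0) + B * (B * A0)) * (h₁ ^ 2 + h₂ ^ 2) := by
      positivity
    have M2 : 0 ≤ (B * (B * A0)) * τ ^ 2 := by positivity
    have M3 : 0 ≤ (4 * A0 + (B * A0) ^ 2 + B * A0 ^ 2 * (B * A0)) * d := by positivity
    have M4 : 0 ≤ A0 * τ ^ 2 := by positivity
    have M5 : 0 ≤ A0 * h₁ ^ 2 := by positivity
    have M6 : 0 ≤ A0 * h₂ ^ 2 := by positivity
    have key : A0 * τ ^ 2 + 2 * A0 * h₁ ^ 2 + 2 * A0 * h₂ ^ 2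
        + ((B * A0) ^ 2 * τ ^ 2 + (B * d + B * A0 ^ 2 * τ ^ 2) * (B * A0))
        ≤ A * (τ ^ 2 + h₁ ^ 2 + h₂ ^ 2 + d) := by
      rw [hA]; linarith
    refine le_trans ?_ key
    unfold lapE
    rw [abs_le] at *
    constructor <;> linarith
  · intro uh d hd
    have hd0 : 0 ≤ d := (abs_nonneg _).trans hd
    have a1 := trap_div (fun s => rE u (x, y, s)) _ _ _ t τ A0 hτ
      (fun s => pt_hasDerivAt (w1 3 hr) x y s) (fun s => pt_hasDerivAt (w1 2 r1) x y s)
      (fun s => pt_hasDerivAt (w1 1 r2) x y s)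
      (fun s hs0 hs1 => (q10 x y s (by linarith) (by linarith) (by linarith) (by linarith)
        (by linarith) (by linarith)).trans (by linarith))
    have a4 := prod_avg (b (u (x, y, t))) (b (u (x, y, t + τ))) (b uh) (pt u (x, y, t))
      (pt u (x, y, t + τ)) (B * A0) _ τ (by positivity) hτ.le hb7 (v7g.trans hA0τ) (hQ uh d hd)
      ((c6g _ ht (by linarith)).trans hBA) ((c6g _ (by linarith) htT).trans hBA)
    rw [ptr, ptr] at a1
    have M2 : 0 ≤ (B * (B * A0)) * τ ^ 2 := by positivity
    have M3 : 0 ≤ (4 * A0 + (B * A0) ^ 2 + B * A0 ^ 2 * (B * A0)) * d := by positivity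
    have M4 : 0 ≤ A0 * τ ^ 2 := by positivity
    have M5 : 0 ≤ (B * A0) ^ 2 * τ ^ 2 + (B * d + B * A0 ^ 2 * τ ^ 2) * (B * A0) := by positivity
    have key : A0 * τ ^ 2
        + ((B * A0) ^ 2 * τ ^ 2 + (B * d + B * A0 ^ 2 * τ ^ 2) * (B * A0))
        ≤ A * (τ ^ 2 + d) := by
      rw [hA]; linarith
    refine le_trans ?_ key
    rw [abs_le] at *
    constructor <;> linarith
  · exact (c6g _ ht (by linarith)).trans (by linarith)
  · exact (c6g _ (by linarith) htT).trans (by linarith)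
  · exact c7g.trans (mul_le_mul_of_nonneg_right (by linarith) hτ.le)
  · intro htτ
    refine (second_diff (fun s => u (x, y, s)) _ _ t τ A0 hτ.le du dv ?_).trans
      (mul_le_mul_of_nonneg_right (by linarith) τ2.le)
    intro s hs0 hs1
    exact (q2 x y s (by linarith) (by linarith) (by linarith) (by linarith)
        (by linarith) (by linarith)).trans (by linarith)


/-! ### Discrete energy -/

/-- Sum over one period of the grid. -/
noncomputable def gS (N₁ N₂ : ℕ) (F : ℤ × ℤ → ℝ) : ℝ :=
  ∑ j₁ ∈ Finset.range N₁, ∑ j₂ ∈ Finset.range N₂, F ((j₁ : ℤ), (j₂ : ℤ))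

/-- Energy density of the error. -/
noncomputable def dens (h₁ h₂ : ℝ) (e f g : ℤ × ℤ → ℝ) (j : ℤ × ℤ) : ℝ :=
  e j ^ 2 + dx h₁ e j ^ 2 + dy h₂ e j ^ 2 + f j ^ 2 + g j ^ 2

/-- The term that cancels by summation by parts. -/
noncomputable def canc (h₁ h₂ : ℝ) (w z : ℤ × ℤ → ℝ) (j : ℤ × ℤ) : ℝ :=
  (dxx h₁ w j * z j + dx h₁ w j * dx h₁ z j) + (dyy h₂ w j * z j + dy h₂ w j * dy h₂ z j)

lemma sbp_1d (N : ℕ) (h : ℝ) (w z : ℤ → ℝ) (hw : ∀ j, w (j + N) = w j)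
    (hz : ∀ j, z (j + N) = z j) :
    ∑ j ∈ Finset.range N, ((w ((j:ℤ) + 1) - 2 * w j + w ((j:ℤ) - 1)) / h ^ 2 * z j
      + (w ((j:ℤ) + 1) - w j) / h * ((z ((j:ℤ) + 1) - z j) / h)) = 0 := by
  have e : ∀ j ∈ Finset.range N, ((w ((j:ℤ) + 1) - 2 * w j + w ((j:ℤ) - 1)) / h ^ 2 * z j
      + (w ((j:ℤ) + 1) - w j) / h * ((z ((j:ℤ) + 1) - z j) / h))
      = (fun k : ℕ => (w (k:ℤ) - w ((k:ℤ) - 1)) * z k / h ^ 2) (j + 1)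
        - (fun k : ℕ => (w (k:ℤ) - w ((k:ℤ) - 1)) * z k / h ^ 2) j := by
    intro j _
    simp only [Nat.cast_add, Nat.cast_one, add_sub_cancel_right]
    ring
  rw [Finset.sum_congr rfl e,
    Finset.sum_range_sub (fun k : ℕ => (w (k:ℤ) - w ((k:ℤ) - 1)) * z k / h ^ 2)]
  have h1 := hw 0
  have h2 := hw (-1)
  have h3 := hz 0
  rw [zero_add] at h1 h3
  rw [show (-1 + (N:ℤ)) = (N:ℤ) - 1 by ring] at h2
  simp only [Nat.cast_zero, zero_sub, h1, h2, h3, sub_self]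

lemma gS_canc (N₁ N₂ : ℕ) (h₁ h₂ : ℝ) (w z : ℤ × ℤ → ℝ) (hw : GridPeriodic N₁ N₂ w)
    (hz : GridPeriodic N₁ N₂ z) : gS N₁ N₂ (canc h₁ h₂ w z) = 0 := by
  unfold gS canc
  simp only [Finset.sum_add_distrib (f := fun j : ℕ => dxx h₁ w (_, (j:ℤ)) * z (_, (j:ℤ))
    + dx h₁ w (_, (j:ℤ)) * dx h₁ z (_, (j:ℤ)))]
  rw [Finset.sum_add_distrib]
  have a : ∑ j₁ ∈ Finset.range N₁, ∑ j₂ ∈ Finset.range N₂,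
      (dxx h₁ w ((j₁:ℤ), (j₂:ℤ)) * z ((j₁:ℤ), (j₂:ℤ))
        + dx h₁ w ((j₁:ℤ), (j₂:ℤ)) * dx h₁ z ((j₁:ℤ), (j₂:ℤ))) = 0 := by
    rw [Finset.sum_comm]
    refine Finset.sum_eq_zero (fun j₂ _ => ?_)
    exact sbp_1d N₁ h₁ (fun k => w (k, (j₂:ℤ))) (fun k => z (k, (j₂:ℤ)))
      (fun k => (hw k j₂).1) (fun k => (hz k j₂).1)
  have c : ∑ j₁ ∈ Finset.range N₁, ∑ j₂ ∈ Finset.range N₂,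
      (dyy h₂ w ((j₁:ℤ), (j₂:ℤ)) * z ((j₁:ℤ), (j₂:ℤ))
        + dy h₂ w ((j₁:ℤ), (j₂:ℤ)) * dy h₂ z ((j₁:ℤ), (j₂:ℤ))) = 0 := by
    refine Finset.sum_eq_zero (fun j₁ _ => ?_)
    exact sbp_1d N₂ h₂ (fun k => w ((j₁:ℤ), k)) (fun k => z ((j₁:ℤ), k))
      (fun k => (hw j₁ k).2) (fun k => (hz j₁ k).2)
  rw [a, c, add_zero]

lemma gS_mono (N₁ N₂ : ℕ) (F G : ℤ × ℤ → ℝ)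
    (h : ∀ j₁ j₂ : ℕ, j₁ < N₁ → j₂ < N₂ → F ((j₁:ℤ), (j₂:ℤ)) ≤ G ((j₁:ℤ), (j₂:ℤ))) :
    gS N₁ N₂ F ≤ gS N₁ N₂ G :=
  Finset.sum_le_sum fun j₁ h1 => Finset.sum_le_sum fun j₂ h2 =>
    h j₁ j₂ (Finset.mem_range.1 h1) (Finset.mem_range.1 h2)

lemma gS_add (N₁ N₂ : ℕ) (F G : ℤ × ℤ → ℝ) :
    gS N₁ N₂ (fun j => F j + G j) = gS N₁ N₂ F + gS N₁ N₂ G := by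
  simp only [gS, Finset.sum_add_distrib]

lemma gS_smul (N₁ N₂ : ℕ) (c : ℝ) (F : ℤ × ℤ → ℝ) :
    gS N₁ N₂ (fun j => c * F j) = c * gS N₁ N₂ F := by
  simp only [gS, Finset.mul_sum]

lemma gS_const (N₁ N₂ : ℕ) (c : ℝ) :
    gS N₁ N₂ (fun _ => c) = N₁ * N₂ * c := by
  simp [gS, mul_assoc]

lemma gS_nonneg (N₁ N₂ : ℕ) (F : ℤ × ℤ → ℝ) (h : ∀ j, 0 ≤ F j) : 0 ≤ gS N₁ N₂ F :=
  Finset.sum_nonneg fun _ _ => Finset.sum_nonneg fun _ _ => h _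

lemma n_mul_bound (c n a1 a2 a3 a4 q q' : ℝ) (hc : 1 ≤ c)
    (hn : |n| ≤ c * (|a1| + |a2| + |a3| + |a4|)) :
    |n * (q' + q)| ≤ 2 * c * (a1 ^ 2 + a2 ^ 2 + a3 ^ 2 + a4 ^ 2 + q ^ 2 + q' ^ 2) := by
  have h2 : (|a1| + |a2| + |a3| + |a4|) * |q' + q|
      ≤ 2 * (a1 ^ 2 + a2 ^ 2 + a3 ^ 2 + a4 ^ 2 + q ^ 2 + q' ^ 2) := by
    have k1 : (|a1| + |a2| + |a3| + |a4|) ^ 2 ≤ 4 * (a1 ^ 2 + a2 ^ 2 + a3 ^ 2 + a4 ^ 2) := by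
      rw [← sq_abs a1, ← sq_abs a2, ← sq_abs a3, ← sq_abs a4]
      linarith [sq_nonneg (|a1| - |a2|), sq_nonneg (|a1| - |a3|), sq_nonneg (|a1| - |a4|),
        sq_nonneg (|a2| - |a3|), sq_nonneg (|a2| - |a4|), sq_nonneg (|a3| - |a4|)]
    have k2 : |q' + q| ^ 2 ≤ 2 * (q ^ 2 + q' ^ 2) := by
      rw [sq_abs]; linarith [sq_nonneg (q' - q)]
    have k3 := sq_nonneg ((|a1| + |a2| + |a3| + |a4|) - 2 * |q' + q|)
    have k4 : 0 ≤ a1 ^ 2 + a2 ^ 2 + a3 ^ 2 + a4 ^ 2 := by positivity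
    generalize |a1| + |a2| + |a3| + |a4| = S at *
    generalize |q' + q| = w at *
    linarith
  rw [abs_mul]
  calc |n| * |q' + q| ≤ c * (|a1| + |a2| + |a3| + |a4|) * |q' + q| :=
        mul_le_mul_of_nonneg_right hn (abs_nonneg _)
    _ = c * ((|a1| + |a2| + |a3| + |a4|) * |q' + q|) := by ring
    _ ≤ c * (2 * (a1 ^ 2 + a2 ^ 2 + a3 ^ 2 + a4 ^ 2 + q ^ 2 + q' ^ 2)) :=
        mul_le_mul_of_nonneg_left h2 (by linarith)
    _ = _ := by ring

/-- Pointwise energy inequality. -/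
lemma energy_pt (τ c e e' em f f' g g' X X' Y Y' L L' fx fx' fy fy' ξ ξx ξy η ζ n1 n2 : ℝ)
    (hτ : 0 < τ) (hc : 1 ≤ c)
    (he : (e' - e) / τ = (f' + f) / 2 + ξ)
    (hX : (X' - X) / τ = (fx' + fx) / 2 + ξx)
    (hY : (Y' - Y) / τ = (fy' + fy) / 2 + ξy)
    (hf : (f' - f) / τ = (L' + L) / 2 - n1 + η)
    (hg : (g' - g) / τ = 1 / 2 * n2 + ζ)
    (hn1 : |n1| ≤ c * (|e| + |em| + |g| + |g'|))
    (hn2 : |n2| ≤ c * (|e| + |em| + |f| + |f'|)) :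
    (e' ^ 2 + X' ^ 2 + Y' ^ 2 + f' ^ 2 + g' ^ 2) - (e ^ 2 + X ^ 2 + Y ^ 2 + f ^ 2 + g ^ 2)
      ≤ τ / 2 * ((L' + L) * (f' + f) + (X' + X) * (fx' + fx) + (Y' + Y) * (fy' + fy))
        + 8 * c * τ * ((e' ^ 2 + X' ^ 2 + Y' ^ 2 + f' ^ 2 + g' ^ 2)
          + (e ^ 2 + X ^ 2 + Y ^ 2 + f ^ 2 + g ^ 2) + em ^ 2)
        + τ * (ξ ^ 2 + ξx ^ 2 + ξy ^ 2) + τ * (η * (f' + f)) + τ * (ζ * (g' + g)) := by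
  rw [div_eq_iff hτ.ne'] at he hX hY hf hg
  have i1 : (f' + f) / 2 * (e' + e) ≤ (f' ^ 2 + f ^ 2 + e' ^ 2 + e ^ 2) / 2 := by
    nlinarith [sq_nonneg (f' - f), sq_nonneg (e' - e), sq_nonneg (f' + f - e' - e)]
  have i2 : ∀ p q q' : ℝ, p * (q' + q) ≤ p ^ 2 + (q' ^ 2 + q ^ 2) / 2 := by
    intro p q q'
    nlinarith [sq_nonneg (p - (q' + q) / 2), sq_nonneg (q' - q)]
  have i3 := fun n a1 a2 a3 a4 q q' => n_mul_bound c n a1 a2 a3 a4 q q' hc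
  have j1 := (abs_le.1 (i3 n1 e em g g' f f' hn1)).1
  have j2 := (abs_le.1 (i3 n2 e em f f' g g' hn2)).2
  have j3 := i2 ξ e e'
  have j4 := i2 ξx X X'
  have j5 := i2 ξy Y Y'
  obtain ⟨D, hD⟩ : ∃ D, D = (e' ^ 2 + X' ^ 2 + Y' ^ 2 + f' ^ 2 + g' ^ 2)
          + (e ^ 2 + X ^ 2 + Y ^ 2 + f ^ 2 + g ^ 2) + em ^ 2 := ⟨_, rfl⟩
  have hDn : 0 ≤ D := by rw [hD]; positivity
  have hcD : D ≤ c * D := by nlinarith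
  have s1 : e ^ 2 + em ^ 2 + g ^ 2 + g' ^ 2 + f ^ 2 + f' ^ 2 ≤ D := by
    rw [hD]; linarith [sq_nonneg e', sq_nonneg X, sq_nonneg X', sq_nonneg Y, sq_nonneg Y']
  have s2 : 2 * c * (e ^ 2 + em ^ 2 + g ^ 2 + g' ^ 2 + f ^ 2 + f' ^ 2) ≤ 2 * c * D :=
    mul_le_mul_of_nonneg_left s1 (by linarith)
  have key : (f' + f) / 2 * (e' + e) + ξ * (e' + e) + ξx * (X' + X) + ξy * (Y' + Y)
      - n1 * (f' + f) + 1 / 2 * (n2 * (g' + g))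
      ≤ 8 * (c * D) + (ξ ^ 2 + ξx ^ 2 + ξy ^ 2) := by
    have s3 : (f' ^ 2 + f ^ 2 + e' ^ 2 + e ^ 2) / 2 + (e' ^ 2 + e ^ 2) / 2 + (X' ^ 2 + X ^ 2) / 2
       + (Y' ^ 2 + Y ^ 2) / 2 ≤ D := by
      rw [hD]
      linarith [sq_nonneg e', sq_nonneg e, sq_nonneg X, sq_nonneg X', sq_nonneg Y, sq_nonneg Y',
        sq_nonneg f, sq_nonneg f', sq_nonneg g, sq_nonneg g', sq_nonneg em]
    linarith
  have key2 := mul_le_mul_of_nonneg_left key hτ.le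
  rw [← hD]
  have id1 : (e' ^ 2 + X' ^ 2 + Y' ^ 2 + f' ^ 2 + g' ^ 2) - (e ^ 2 + X ^ 2 + Y ^ 2 + f ^ 2 + g ^ 2)
     = (e' - e) * (e' + e) + (X' - X) * (X' + X) + (Y' - Y) * (Y' + Y)
       + (f' - f) * (f' + f) + (g' - g) * (g' + g) := by ring
  rw [id1, he, hX, hY, hf, hg]
  linarith

lemma n_bound (B A ε bh bH r r' R R' : ℝ) (hA : 0 ≤ A) (h1 : |bh - bH| ≤ B * ε)
    (h2 : |bH| ≤ 1) (hr : |r| ≤ A) (hr' : |r'| ≤ A) :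
    |bh * ((r' + r) / 2) - bH * ((R' + R) / 2)| ≤ B * ε * A + (|r - R| + |r' - R'|) := by
  have e : bh * ((r' + r) / 2) - bH * ((R' + R) / 2)
    = (bh - bH) * ((r' + r) / 2) + bH * (((r' - R') + (r - R)) / 2) := by ring
  rw [e]
  refine (abs_add_le _ _).trans (add_le_add ?_ ?_)
  · rw [abs_mul]
    refine mul_le_mul h1 ?_ (abs_nonneg _) ((abs_nonneg _).trans h1)
    rw [abs_le] at *; constructor <;> linarith
  · rw [abs_mul]
    calc |bH| * |((r' - R') + (r - R)) / 2| ≤ 1 * |((r' - R') + (r - R)) / 2| :=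
          mul_le_mul_of_nonneg_right h2 (abs_nonneg _)
      _ ≤ _ := by
        rw [one_mul, abs_div, abs_two]
        have := abs_add_le (r' - R') (r - R)
        have := abs_nonneg (r' - R')
        have := abs_nonneg (r - R)
        linarith

set_option maxHeartbeats 1000000 in
lemma step_pt (u : ℝ × ℝ × ℝ → ℝ) (A B xL yL t τ h₁ h₂ : ℝ) (hA : 1 ≤ A) (hB : 1 ≤ B)
    (hτ : 0 < τ)
    (hBl : ∀ x y, |b x - b y| ≤ B * |x - y|)
    (j : ℤ × ℤ)
    (hC : Consis u A (xL + j.1 * h₁) (yL + j.2 * h₂) t τ h₁ h₂)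
    (un un' vn vn' rn rn' U U' V V' R R' : ℤ × ℤ → ℝ)
    (hun : ∀ j : ℤ × ℤ, un j = u (xL + j.1 * h₁, yL + j.2 * h₂, t))
    (hun' : ∀ j : ℤ × ℤ, un' j = u (xL + j.1 * h₁, yL + j.2 * h₂, t + τ))
    (hvn : ∀ j : ℤ × ℤ, vn j = pt u (xL + j.1 * h₁, yL + j.2 * h₂, t))
    (hvn' : ∀ j : ℤ × ℤ, vn' j = pt u (xL + j.1 * h₁, yL + j.2 * h₂, t + τ))
    (hrn : ∀ j : ℤ × ℤ, rn j = rE u (xL + j.1 * h₁, yL + j.2 * h₂, t))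
    (hrn' : ∀ j : ℤ × ℤ, rn' j = rE u (xL + j.1 * h₁, yL + j.2 * h₂, t + τ))
    (uh Uh em d : ℝ)
    (hd : |uh - (u (xL + j.1 * h₁, yL + j.2 * h₂, t + τ)
      + u (xL + j.1 * h₁, yL + j.2 * h₂, t)) / 2| ≤ d)
    (hUh : |uh - Uh| ≤ 2 * (|un j - U j| + |em|))
    (s1 : ∀ j : ℤ × ℤ, (U' j - U j) / τ = (V' j + V j) / 2)
    (s2 : (V' j - V j) / τ = dxx h₁ (fun k => (U' k + U k) / 2) j
          + dyy h₂ (fun k => (U' k + U k) / 2) j - b Uh * (R' j + R j) / 2)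
    (s3 : (R' j - R j) / τ = (1/2) * b Uh * (V' j + V j) / 2) :
    ∃ η ζ : ℝ, |η| ≤ A * (τ ^ 2 + h₁ ^ 2 + h₂ ^ 2 + d) ∧ |ζ| ≤ A * (τ ^ 2 + d) ∧
      dens h₁ h₂ (fun j => un' j - U' j) (fun j => vn' j - V' j) (fun j => rn' j - R' j) j
      - dens h₁ h₂ (fun j => un j - U j) (fun j => vn j - V j) (fun j => rn j - R j) j
      ≤ τ / 2 * canc h₁ h₂ (fun j => (un' j - U' j) + (un j - U j))
          (fun j => (vn' j - V' j) + (vn j - V j)) j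
        + 8 * (4 * B * A) * τ * (
          dens h₁ h₂ (fun j => un' j - U' j) (fun j => vn' j - V' j) (fun j => rn' j - R' j) j
          + dens h₁ h₂ (fun j => un j - U j) (fun j => vn j - V j) (fun j => rn j - R j) j
          + em ^ 2)
        + τ * (3 * (A * τ ^ 2) ^ 2) + τ * (η * ((vn' j - V' j) + (vn j - V j)))
        + τ * (ζ * ((rn' j - R' j) + (rn j - R j))) := by
  obtain ⟨j1, j2⟩ := j
  simp only at hC hd
  have px1 : xL + ((j1 + 1 : ℤ) : ℝ) * h₁ = xL + j1 * h₁ + h₁ := by push_cast; ring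
  have px2 : xL + ((j1 - 1 : ℤ) : ℝ) * h₁ = xL + j1 * h₁ - h₁ := by push_cast; ring
  have py1 : yL + ((j2 + 1 : ℤ) : ℝ) * h₂ = yL + j2 * h₂ + h₂ := by push_cast; ring
  have py2 : yL + ((j2 - 1 : ℤ) : ℝ) * h₂ = yL + j2 * h₂ - h₂ := by push_cast; ring
  have hC4 := hC.c4 uh d hd
  have hC5 := hC.c5 uh d hd
  have hBA : 1 ≤ B * A := by nlinarith
  refine ⟨_, _, hC4, hC5, ?_⟩
  have hbU := (hBl uh Uh).trans (mul_le_mul_of_nonneg_left hUh (by linarith))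
  have hr2 : ∀ p, |rE u p| ≤ 2 := fun p => by
    unfold rE
    rw [abs_of_nonneg (Real.sqrt_nonneg _)]
    exact sqrt_le_two _
  have nb1 := n_bound B 2 _ (b uh) (b Uh) (rn (j1, j2)) (rn' (j1, j2)) (R (j1, j2)) (R' (j1, j2))
    (by norm_num) hbU (b_abs_le _) (by rw [hrn]; exact hr2 _) (by rw [hrn']; exact hr2 _)
  have nb2 := n_bound B A _ (b uh) (b Uh) (vn (j1, j2)) (vn' (j1, j2)) (V (j1, j2)) (V' (j1, j2))
    (by linarith) hbU (b_abs_le _) (by rw [hvn]; exact hC.c6) (by rw [hvn']; exact hC.c6')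
  have ae := abs_nonneg (un (j1, j2) - U (j1, j2))
  have aem := abs_nonneg em
  have E := energy_pt τ (4 * B * A) (un (j1, j2) - U (j1, j2)) (un' (j1, j2) - U' (j1, j2)) em
    (vn (j1, j2) - V (j1, j2)) (vn' (j1, j2) - V' (j1, j2))
    (rn (j1, j2) - R (j1, j2)) (rn' (j1, j2) - R' (j1, j2))
    (dx h₁ (fun j => un j - U j) (j1, j2)) (dx h₁ (fun j => un' j - U' j) (j1, j2))
    (dy h₂ (fun j => un j - U j) (j1, j2)) (dy h₂ (fun j => un' j - U' j) (j1, j2))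
    (dxx h₁ (fun j => un j - U j) (j1, j2) + dyy h₂ (fun j => un j - U j) (j1, j2))
    (dxx h₁ (fun j => un' j - U' j) (j1, j2) + dyy h₂ (fun j => un' j - U' j) (j1, j2))
    (dx h₁ (fun j => vn j - V j) (j1, j2)) (dx h₁ (fun j => vn' j - V' j) (j1, j2))
    (dy h₂ (fun j => vn j - V j) (j1, j2)) (dy h₂ (fun j => vn' j - V' j) (j1, j2))
    (n1 := b uh * ((rn' (j1, j2) + rn (j1, j2)) / 2) - b Uh * ((R' (j1, j2) + R (j1, j2)) / 2))
    (n2 := b uh * ((vn' (j1, j2) + vn (j1, j2)) / 2) - b Uh * ((V' (j1, j2) + V (j1, j2)) / 2))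
    (hτ := hτ) (hc := by linarith)
    (ξ := (u (xL + j1 * h₁, yL + j2 * h₂, t + τ) - u (xL + j1 * h₁, yL + j2 * h₂, t)) / τ
      - (pt u (xL + j1 * h₁, yL + j2 * h₂, t + τ) + pt u (xL + j1 * h₁, yL + j2 * h₂, t)) / 2)
    (ξx := ((u (xL + j1 * h₁ + h₁, yL + j2 * h₂, t + τ) - u (xL + j1 * h₁, yL + j2 * h₂, t + τ)) / h₁
        - (u (xL + j1 * h₁ + h₁, yL + j2 * h₂, t) - u (xL + j1 * h₁, yL + j2 * h₂, t)) / h₁) / τ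
    - ((pt u (xL + j1 * h₁ + h₁, yL + j2 * h₂, t + τ) - pt u (xL + j1 * h₁, yL + j2 * h₂, t + τ)) / h₁
      + (pt u (xL + j1 * h₁ + h₁, yL + j2 * h₂, t) - pt u (xL + j1 * h₁, yL + j2 * h₂, t)) / h₁) / 2)
    (ξy := ((u (xL + j1 * h₁, yL + j2 * h₂ + h₂, t + τ) - u (xL + j1 * h₁, yL + j2 * h₂, t + τ)) / h₂
        - (u (xL + j1 * h₁, yL + j2 * h₂ + h₂, t) - u (xL + j1 * h₁, yL + j2 * h₂, t)) / h₂) / τ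
    - ((pt u (xL + j1 * h₁, yL + j2 * h₂ + h₂, t + τ) - pt u (xL + j1 * h₁, yL + j2 * h₂, t + τ)) / h₂
      + (pt u (xL + j1 * h₁, yL + j2 * h₂ + h₂, t) - pt u (xL + j1 * h₁, yL + j2 * h₂, t)) / h₂) / 2)
    (η := (pt u (xL + j1 * h₁, yL + j2 * h₂, t + τ) - pt u (xL + j1 * h₁, yL + j2 * h₂, t)) / τ
      - (lapE u h₁ h₂ (xL + j1 * h₁) (yL + j2 * h₂) (t + τ)
        + lapE u h₁ h₂ (xL + j1 * h₁) (yL + j2 * h₂) t) / 2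
      + b uh * ((rE u (xL + j1 * h₁, yL + j2 * h₂, t + τ)
        + rE u (xL + j1 * h₁, yL + j2 * h₂, t)) / 2))
    (ζ := (rE u (xL + j1 * h₁, yL + j2 * h₂, t + τ) - rE u (xL + j1 * h₁, yL + j2 * h₂, t)) / τ
      - 1 / 2 * b uh * ((pt u (xL + j1 * h₁, yL + j2 * h₂, t + τ)
        + pt u (xL + j1 * h₁, yL + j2 * h₂, t)) / 2))
    (by
      simp only [hun, hun', hvn, hvn']
      linear_combination -(s1 (j1, j2)))
    (by
      simp only [dx, hun, hun', hvn, hvn', px1]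
      linear_combination (-(1 / h₁)) * (s1 (j1 + 1, j2)) + (1 / h₁) * (s1 (j1, j2)))
    (by
      simp only [dy, hun, hun', hvn, hvn', py1]
      linear_combination (-(1 / h₂)) * (s1 (j1, j2 + 1)) + (1 / h₂) * (s1 (j1, j2)))
    (by
      simp only [dxx, dyy] at s2
      simp only [dxx, dyy, lapE, hun, hun', hvn, hvn', hrn, hrn', px1, px2, py1, py2]
      linear_combination -s2)
    (by
      simp only [hvn, hvn', hrn, hrn']
      linear_combination -s3)
    (by
      refine nb1.trans ?_
      have := abs_nonneg (rn (j1, j2) - R (j1, j2))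
      have := abs_nonneg (rn' (j1, j2) - R' (j1, j2))
      have z1 : |rn (j1, j2) - R (j1, j2)| + |rn' (j1, j2) - R' (j1, j2)|
        ≤ 4 * B * A * (|rn (j1, j2) - R (j1, j2)| + |rn' (j1, j2) - R' (j1, j2)|) :=
        le_mul_of_one_le_left (by positivity) (by linarith)
      have z2 : B * 1 ≤ B * A := mul_le_mul_of_nonneg_left hA (by linarith)
      have z3 : B * 1 * (|un (j1, j2) - U (j1, j2)| + |em|)
        ≤ B * A * (|un (j1, j2) - U (j1, j2)| + |em|) :=
        mul_le_mul_of_nonneg_right z2 (by positivity)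
      linarith)
    (by
      refine nb2.trans ?_
      have := abs_nonneg (vn (j1, j2) - V (j1, j2))
      have := abs_nonneg (vn' (j1, j2) - V' (j1, j2))
      have z1 : |vn (j1, j2) - V (j1, j2)| + |vn' (j1, j2) - V' (j1, j2)|
        ≤ 4 * B * A * (|vn (j1, j2) - V (j1, j2)| + |vn' (j1, j2) - V' (j1, j2)|) :=
        le_mul_of_one_le_left (by positivity) (by linarith)
      have z3 : 0 ≤ B * A * (|un (j1, j2) - U (j1, j2)| + |em|) := by positivity
      linarith)
  have q1 := sq_le_sq' (abs_le.1 hC.c1).1 (abs_le.1 hC.c1).2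
  have q2 := sq_le_sq' (abs_le.1 hC.c2).1 (abs_le.1 hC.c2).2
  have q3 := sq_le_sq' (abs_le.1 hC.c3).1 (abs_le.1 hC.c3).2
  have q4 := mul_le_mul_of_nonneg_left (add_le_add (add_le_add q1 q2) q3) hτ.le
  have hcanc : canc h₁ h₂ (fun j => (un' j - U' j) + (un j - U j))
          (fun j => (vn' j - V' j) + (vn j - V j)) (j1, j2)
     = (dxx h₁ (fun j => un' j - U' j) (j1, j2) + dyy h₂ (fun j => un' j - U' j) (j1, j2)
        + (dxx h₁ (fun j => un j - U j) (j1, j2) + dyy h₂ (fun j => un j - U j) (j1, j2)))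
        * ((vn' (j1, j2) - V' (j1, j2)) + (vn (j1, j2) - V (j1, j2)))
      + (dx h₁ (fun j => un' j - U' j) (j1, j2) + dx h₁ (fun j => un j - U j) (j1, j2))
        * (dx h₁ (fun j => vn' j - V' j) (j1, j2) + dx h₁ (fun j => vn j - V j) (j1, j2))
      + (dy h₂ (fun j => un' j - U' j) (j1, j2) + dy h₂ (fun j => un j - U j) (j1, j2))
        * (dy h₂ (fun j => vn' j - V' j) (j1, j2) + dy h₂ (fun j => vn j - V j) (j1, j2)) := by
    simp only [canc, dxx, dyy, dx, dy]; ring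
  rw [hcanc]
  unfold dens
  linarith

lemma gronwall (M : ℕ) (a Q : ℝ) (E : ℕ → ℝ) (ha : 0 ≤ a) (ha' : a ≤ 1 / 4) (hQ : 0 ≤ Q)
    (hE : ∀ n, 0 ≤ E n)
    (h0 : E 0 = 0) (h1 : E 1 ≤ 2 * Q)
    (hs : ∀ n, 1 ≤ n → n + 1 ≤ M → E (n + 1) - E n ≤ a * (E (n + 1) + E n + E (n - 1)) + a * Q) :
    ∀ n, n ≤ M → E n + Q ≤ (1 + 6 * a) ^ n * (3 * Q) := by
  intro n
  induction n using Nat.strong_induction_on with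
  | _ n ih =>
    intro hn
    rcases n with _ | _ | n
    · simp [h0]; linarith
    · rw [zero_add, pow_one]; nlinarith
    · have i1 := ih (n + 1) (by omega) (by omega)
      have i0 := ih n (by omega) (by omega)
      have st := hs (n + 1) (by omega) hn
      simp only [Nat.add_sub_cancel] at st
      have hm : (1 + 6 * a) ^ n * (3 * Q) ≤ (1 + 6 * a) ^ (n + 1) * (3 * Q) := by
        refine mul_le_mul_of_nonneg_right ?_ (by linarith)
        exact pow_le_pow_right₀ (by linarith) (by omega)
      have i0' := i0.trans hm
      rw [pow_succ _ (n + 1)]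
      obtain ⟨G, hG⟩ : ∃ G, G = (1 + 6 * a) ^ (n + 1) * (3 * Q) := ⟨_, rfl⟩
      rw [← hG] at i1 i0'
      have eq : (1 + 6 * a) ^ (n + 1) * (1 + 6 * a) * (3 * Q) = (1 + 6 * a) * G := by
        rw [hG]; ring
      rw [eq]
      have hE1 := hE (n + 1)
      have hE0 := hE n
      -- (1 - a) E₂ ≤ (1 + a) (G - Q) + a (G - Q) + a Q
      have k1 : (1 - a) * (E (n + 1 + 1) + Q) ≤ (1 + 2 * a) * G - a * Q * 2 := by
        nlinarith
      have hG0 : 0 ≤ G := by linarith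
      have k2 : (1 + 2 * a) * G ≤ (1 - a) * ((1 + 6 * a) * G) := by
        nlinarith [mul_nonneg ha hG0, mul_nonneg (mul_nonneg ha hG0) (by linarith : 0 ≤ 1/4 - a)]
      have k3 : (1 - a) * (E (n + 1 + 1) + Q) ≤ (1 - a) * ((1 + 6 * a) * G) := by
        nlinarith [mul_nonneg ha hQ]
      exact le_of_mul_le_mul_left k3 (by linarith)

lemma half_diff (p q d : ℝ) (h : |p - q| ≤ d) : |q - (p + q) / 2| ≤ d := by
  have h0 := (abs_nonneg _).trans h
  rw [abs_le] at h ⊢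
  constructor <;> linarith

lemma tail1 (τ c Δ W D D' m em f f' g g' η ζ A ε : ℝ) (hτ : 0 < τ) (hc : 1 ≤ c) (hA : 1 ≤ A)
    (h : Δ ≤ W + 8 * c * τ * (D' + D + em ^ 2) + τ * (3 * (A * τ ^ 2) ^ 2)
      + τ * (η * (f' + f)) + τ * (ζ * (g' + g)))
    (hD : f ^ 2 + g ^ 2 ≤ D) (hD' : f' ^ 2 + g' ^ 2 ≤ D') (hm : em ^ 2 ≤ m)
    (hε : τ ^ 2 ≤ ε)
    (hη : |η| ≤ 3 * A ^ 2 * ε) (hζ : |ζ| ≤ 3 * A ^ 2 * ε) :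
    Δ ≤ W + 9 * c * τ * (D' + D + m) + 45 * A ^ 4 * ε ^ 2 * τ := by
  have i2 : ∀ p q q' : ℝ, p * (q' + q) ≤ p ^ 2 + (q' ^ 2 + q ^ 2) / 2 := by
    intro p q q'
    linarith [sq_nonneg (p - (q' + q) / 2), sq_nonneg (q' - q)]
  have e0 : 0 ≤ ε := (sq_nonneg τ).trans hε
  have q1 := sq_le_sq' (abs_le.1 hη).1 (abs_le.1 hη).2
  have q2 := sq_le_sq' (abs_le.1 hζ).1 (abs_le.1 hζ).2
  have q3 : (A * τ ^ 2) ^ 2 ≤ (A ^ 2 * ε) ^ 2 := by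
    refine pow_le_pow_left₀ (by positivity) ?_ 2
    exact mul_le_mul (by nlinarith) hε (by positivity) (by positivity)
  have D0 : 0 ≤ D := le_trans (by positivity) hD
  have D0' : 0 ≤ D' := le_trans (by positivity) hD'
  have m0 : 0 ≤ m := le_trans (by positivity) hm
  have k0 : 0 ≤ A ^ 4 * ε ^ 2 := by positivity
  have k1 : 3 * (A * τ ^ 2) ^ 2 + η * (f' + f) + ζ * (g' + g)
      ≤ (D' + D + m) + 45 * A ^ 4 * ε ^ 2 := by
    have := i2 η f f'
    have := i2 ζ g g'
    linarith
  have k2 : D' + D + m ≤ c * (D' + D + m) := le_mul_of_one_le_left (by linarith) hc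
  have k3 := mul_le_mul_of_nonneg_left (k1.trans (add_le_add_left k2 _)) hτ.le
  have k4 : 8 * c * τ * (D' + D + em ^ 2) ≤ 8 * c * τ * (D' + D + m) :=
    mul_le_mul_of_nonneg_left (by linarith) (by positivity)
  linarith

lemma tail0 (τ c W D' f' g' η ζ A ε : ℝ) (hτ : 0 < τ) (hτ1 : τ ≤ 1) (hc : 1 ≤ c) (hA : 1 ≤ A)
    (h : D' ≤ W + 8 * c * τ * D' + τ * (3 * (A * τ ^ 2) ^ 2)
      + τ * (η * f') + τ * (ζ * g'))
    (hD' : f' ^ 2 + g' ^ 2 ≤ D')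
    (hε : τ ^ 2 ≤ ε)
    (hη : τ * |η| ≤ 3 * A ^ 2 * ε) (hζ : τ * |ζ| ≤ 3 * A ^ 2 * ε) :
    D' ≤ W + (9 * c * τ + 1 / 4) * D' + 45 * A ^ 4 * ε ^ 2 := by
  have i2 : ∀ p q : ℝ, p * q ≤ p ^ 2 + q ^ 2 / 4 := by
    intro p q
    linarith [sq_nonneg (p - q / 2)]
  rw [← abs_of_pos hτ, ← abs_mul] at hη hζ
  have e0 : 0 ≤ ε := (sq_nonneg τ).trans hε
  have q1 := sq_le_sq' (abs_le.1 hη).1 (abs_le.1 hη).2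
  have q2 := sq_le_sq' (abs_le.1 hζ).1 (abs_le.1 hζ).2
  have q3 : (A * τ ^ 2) ^ 2 ≤ (A ^ 2 * ε) ^ 2 := by
    refine pow_le_pow_left₀ (by positivity) ?_ 2
    exact mul_le_mul (by nlinarith) hε (by positivity) (by positivity)
  have D0' : 0 ≤ D' := le_trans (by positivity) hD'
  have k0 : 0 ≤ A ^ 4 * ε ^ 2 := by positivity
  have k1 : τ * (3 * (A * τ ^ 2) ^ 2) ≤ 1 * (3 * (A * τ ^ 2) ^ 2) :=
    mul_le_mul_of_nonneg_right hτ1 (by positivity)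
  have k2 : 0 ≤ c * τ * D' := by positivity
  have := i2 (τ * η) f'
  have := i2 (τ * ζ) g'
  linarith

lemma dens_nonneg (h₁ h₂ : ℝ) (e f g : ℤ × ℤ → ℝ) (j : ℤ × ℤ) : 0 ≤ dens h₁ h₂ e f g j := by
  unfold dens; positivity

lemma norms_le (N₁ N₂ : ℕ) (h₁ h₂ : ℝ) (hh1 : 0 < h₁) (hh2 : 0 < h₂) (e f g : ℤ × ℤ → ℝ) :
    dH1Norm N₁ N₂ h₁ h₂ e + dNorm N₁ N₂ h₁ h₂ f + dNorm N₁ N₂ h₁ h₂ g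
      ≤ 3 * Real.sqrt (h₁ * h₂ * gS N₁ N₂ (dens h₁ h₂ e f g)) := by
  have nn : ∀ W : ℤ × ℤ → ℝ, 0 ≤ dInner N₁ N₂ h₁ h₂ W W := fun W =>
    mul_nonneg (by positivity) (gS_nonneg N₁ N₂ (fun j => W j * W j) (fun j => mul_self_nonneg _))
  have id1 : h₁ * h₂ * gS N₁ N₂ (dens h₁ h₂ e f g)
      = dInner N₁ N₂ h₁ h₂ e e + dInner N₁ N₂ h₁ h₂ (dx h₁ e) (dx h₁ e)
        + dInner N₁ N₂ h₁ h₂ (dy h₂ e) (dy h₂ e) + dInner N₁ N₂ h₁ h₂ f f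
        + dInner N₁ N₂ h₁ h₂ g g := by
    simp only [gS, dens, dInner, Finset.sum_add_distrib, pow_two]
    ring
  have n1 := nn e
  have n2 := nn (dx h₁ e)
  have n3 := nn (dy h₂ e)
  have n4 := nn f
  have n5 := nn g
  have a1 : dH1Norm N₁ N₂ h₁ h₂ e ≤ Real.sqrt (h₁ * h₂ * gS N₁ N₂ (dens h₁ h₂ e f g)) := by
    unfold dH1Norm dNorm
    rw [Real.sq_sqrt n1, Real.sq_sqrt n2, Real.sq_sqrt n3]
    exact Real.sqrt_le_sqrt (by linarith)
  have a2 : dNorm N₁ N₂ h₁ h₂ f ≤ Real.sqrt (h₁ * h₂ * gS N₁ N₂ (dens h₁ h₂ e f g)) :=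
    Real.sqrt_le_sqrt (by linarith)
  have a3 : dNorm N₁ N₂ h₁ h₂ g ≤ Real.sqrt (h₁ * h₂ * gS N₁ N₂ (dens h₁ h₂ e f g)) :=
    Real.sqrt_le_sqrt (by linarith)
  linarith

lemma sum_step (N₁ N₂ : ℕ) (h₁ h₂ k τ κ : ℝ) (hh1 : 0 < h₁) (hh2 : 0 < h₂)
    (D' P w z : ℤ × ℤ → ℝ) (hw : GridPeriodic N₁ N₂ w) (hz : GridPeriodic N₁ N₂ z)
    (h : ∀ j₁ j₂ : ℕ, j₁ < N₁ → j₂ < N₂ → D' ((j₁:ℤ), (j₂:ℤ)) ≤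
      τ / 2 * canc h₁ h₂ w z ((j₁:ℤ), (j₂:ℤ)) + k * P ((j₁:ℤ), (j₂:ℤ)) + κ) :
    h₁ * h₂ * gS N₁ N₂ D' ≤ k * (h₁ * h₂ * gS N₁ N₂ P) + κ * ((N₁ * h₁) * (N₂ * h₂)) := by
  have h1 := gS_mono N₁ N₂ D' (fun j => (τ / 2 * canc h₁ h₂ w z j + k * P j) + κ) h
  rw [gS_add, gS_add, gS_smul, gS_smul, gS_const, gS_canc N₁ N₂ h₁ h₂ w z hw hz] at h1
  have h2 := mul_le_mul_of_nonneg_left h1 (by positivity : 0 ≤ h₁ * h₂)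
  linarith

set_option maxHeartbeats 4000000 in
theorem LI_LEP_unconditional_optimal_convergence
    (xL xR yL yR T : ℝ) (hx : xL < xR) (hy : yL < yR) (hT : 0 < T)
    (u : ℝ × ℝ × ℝ → ℝ) (hu : ContDiff ℝ 4 u)
    (hperx : ∀ x y t : ℝ, u (x + (xR - xL), y, t) = u (x, y, t))
    (hpery : ∀ x y t : ℝ, u (x, y + (yR - yL), t) = u (x, y, t))
    (hSG : ∀ p : ℝ × ℝ × ℝ,
      pt (pt u) p = px (px u) p + py (py u) p - Real.sin (u p)) :
    ∃ C > 0, ∃ τ₀ > 0,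
      ∀ N₁ N₂ M : ℕ, 0 < N₁ → 0 < N₂ → 0 < M →
      ∀ h₁ h₂ h τ : ℝ,
        h₁ = (xR - xL) / N₁ → h₂ = (yR - yL) / N₂ → h = max h₁ h₂ →
        τ = T / M → τ ≤ τ₀ →
      -- grid samples of the exact solution and of `v = ∂ₜu`, `r = √(2 - cos u)`
      ∀ un vn rn : ℕ → ℤ × ℤ → ℝ,
        (∀ (n : ℕ) (j : ℤ × ℤ),
          un n j = u (xL + j.1 * h₁, yL + j.2 * h₂, n * τ)) →
        (∀ (n : ℕ) (j : ℤ × ℤ),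
          vn n j = pt u (xL + j.1 * h₁, yL + j.2 * h₂, n * τ)) →
        (∀ (n : ℕ) (j : ℤ × ℤ),
          rn n j = Real.sqrt (2 - Real.cos (u (xL + j.1 * h₁, yL + j.2 * h₂, n * τ)))) →
      -- the numerical solution
      ∀ U V R : ℕ → ℤ × ℤ → ℝ,
        (∀ n : ℕ, n ≤ M → GridPeriodic N₁ N₂ (U n) ∧ GridPeriodic N₁ N₂ (V n)
          ∧ GridPeriodic N₁ N₂ (R n)) →
        -- initial data
        U 0 = un 0 → V 0 = vn 0 → R 0 = rn 0 →
        -- first step (n = 0)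
        (∀ j : ℤ × ℤ, (U 1 j - U 0 j) / τ = (V 1 j + V 0 j) / 2) →
        (∀ j : ℤ × ℤ, (V 1 j - V 0 j) / τ =
          dxx h₁ (fun k => (U 1 k + U 0 k) / 2) j
          + dyy h₂ (fun k => (U 1 k + U 0 k) / 2) j
          - b (U 0 j) * (R 1 j + R 0 j) / 2) →
        (∀ j : ℤ × ℤ, (R 1 j - R 0 j) / τ =
          (1/2) * b (U 0 j) * (V 1 j + V 0 j) / 2) →
        -- LI-LEP scheme for 1 ≤ n ≤ M - 1
        (∀ n : ℕ, 1 ≤ n → n ≤ M - 1 → ∀ j : ℤ × ℤ,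
          (U (n+1) j - U n j) / τ = (V (n+1) j + V n j) / 2) →
        (∀ n : ℕ, 1 ≤ n → n ≤ M - 1 → ∀ j : ℤ × ℤ,
          (V (n+1) j - V n j) / τ =
            dxx h₁ (fun k => (U (n+1) k + U n k) / 2) j
            + dyy h₂ (fun k => (U (n+1) k + U n k) / 2) j
            - b ((3 * U n j - U (n-1) j) / 2) * (R (n+1) j + R n j) / 2) →
        (∀ n : ℕ, 1 ≤ n → n ≤ M - 1 → ∀ j : ℤ × ℤ,
          (R (n+1) j - R n j) / τ =
            (1/2) * b ((3 * U n j - U (n-1) j) / 2) * (V (n+1) j + V n j) / 2) →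
      -- conclusion: optimal error estimate in the discrete H¹ norm
      ∀ n : ℕ, n ≤ M →
        dH1Norm N₁ N₂ h₁ h₂ (fun j => un n j - U n j)
          + dNorm N₁ N₂ h₁ h₂ (fun j => vn n j - V n j)
          + dNorm N₁ N₂ h₁ h₂ (fun j => rn n j - R n j)
        ≤ C * (h^2 + τ^2) := by
  obtain ⟨A, hA, hCons⟩ := trunc xL xR yL yR T hx hy u hu hSG
  obtain ⟨B, hB, hBl, -⟩ := b_consts
  have hBA : 1 ≤ B * A := by nlinarith
  obtain ⟨c, hc⟩ : ∃ c, c = 4 * B * A := ⟨_, rfl⟩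
  have hc1 : 1 ≤ c := by rw [hc]; linarith
  have hL1 : 0 < xR - xL := by linarith
  have hL2 : 0 < yR - yL := by linarith
  obtain ⟨G, hG⟩ : ∃ G, G = Real.exp (6 * (9 * c) * T)
    * (3 * (45 * A ^ 4 * ((xR - xL) * (yR - yL)))) := ⟨_, rfl⟩
  have hG0 : 0 < G := by rw [hG]; positivity
  refine ⟨3 * Real.sqrt G, by positivity, min 1 (1 / (4 * (9 * c))), by positivity, ?_⟩
  intro N₁ N₂ M hN1 hN2 hM h₁ h₂ h τ hh1 hh2 hh hτ hτ0 un vn rn hun hvn hrn U V R hper hU0 hV0 hR0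
    s10 s20 s30 s1 s2 s3 n hn
  have hN1' : (0:ℝ) < N₁ := by exact_mod_cast hN1
  have hN2' : (0:ℝ) < N₂ := by exact_mod_cast hN2
  have hM' : (0:ℝ) < M := by exact_mod_cast hM
  have h1p : 0 < h₁ := by rw [hh1]; positivity
  have h2p : 0 < h₂ := by rw [hh2]; positivity
  have hτp : 0 < τ := by rw [hτ]; positivity
  have hNh1 : N₁ * h₁ = xR - xL := by rw [hh1]; field_simp
  have hNh2 : N₂ * h₂ = yR - yL := by rw [hh2]; field_simp
  have hMτ : M * τ = T := by rw [hτ]; field_simp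
  have hτ1 : τ ≤ 1 := hτ0.trans (min_le_left _ _)
  have hτc : 9 * c * τ ≤ 1 / 4 := by
    have := hτ0.trans (min_le_right _ _)
    rw [le_div_iff₀ (by positivity)] at this
    linarith
  have h1L : h₁ ≤ xR - xL := by
    rw [← hNh1]
    exact le_mul_of_one_le_left h1p.le (by exact_mod_cast hN1)
  have h2L : h₂ ≤ yR - yL := by
    rw [← hNh2]
    exact le_mul_of_one_le_left h2p.le (by exact_mod_cast hN2)
  have hh1sq : h₁ ^ 2 ≤ h ^ 2 := pow_le_pow_left₀ h1p.le (by rw [hh]; exact le_max_left _ _) 2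
  have hh2sq : h₂ ^ 2 ≤ h ^ 2 := pow_le_pow_left₀ h2p.le (by rw [hh]; exact le_max_right _ _) 2
  obtain ⟨ε, hε⟩ : ∃ ε, ε = h ^ 2 + τ ^ 2 := ⟨_, rfl⟩
  have hετ : τ ^ 2 ≤ ε := by rw [hε]; linarith [sq_nonneg h]
  have hε0 : 0 ≤ ε := (sq_nonneg τ).trans hετ
  -- consistency at grid points
  have hC : ∀ (m j₁ j₂ : ℕ), m + 1 ≤ M → j₁ < N₁ → j₂ < N₂ →
      Consis u A (xL + ((j₁:ℤ):ℝ) * h₁) (yL + ((j₂:ℤ):ℝ) * h₂) (m * τ) τ h₁ h₂ := by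
    intro m j₁ j₂ hm hj1 hj2
    have e1 : (j₁:ℝ) * h₁ ≤ N₁ * h₁ :=
      mul_le_mul_of_nonneg_right (by exact_mod_cast hj1.le) h1p.le
    have e2 : (j₂:ℝ) * h₂ ≤ N₂ * h₂ :=
      mul_le_mul_of_nonneg_right (by exact_mod_cast hj2.le) h2p.le
    have e3 : ((m:ℝ) + 1) * τ ≤ M * τ :=
      mul_le_mul_of_nonneg_right (by exact_mod_cast hm) hτp.le
    have e4 : 0 ≤ (j₁:ℝ) * h₁ := by positivity
    have e5 : 0 ≤ (j₂:ℝ) * h₂ := by positivity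
    simp only [Int.cast_natCast]
    exact hCons _ _ _ _ _ _ (by linarith) (by linarith) (by linarith) (by linarith)
      (by positivity) hτp (by linarith) h1p h1L h2p h2L
  -- periodicity
  have hperpx : ∀ x y t : ℝ, pt u (x + (xR - xL), y, t) = pt u (x, y, t) := by
    intro x y t; simp only [pt, hperx]
  have hperpy : ∀ x y t : ℝ, pt u (x, y + (yR - yL), t) = pt u (x, y, t) := by
    intro x y t; simp only [pt, hpery]
  have posx : ∀ j₁ : ℤ, xL + ((j₁ + N₁ : ℤ) : ℝ) * h₁ = xL + j₁ * h₁ + (xR - xL) := by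
    intro j₁; push_cast; linarith
  have posy : ∀ j₂ : ℤ, yL + ((j₂ + N₂ : ℤ) : ℝ) * h₂ = yL + j₂ * h₂ + (yR - yL) := by
    intro j₂; push_cast; linarith
  have hupe : ∀ m, GridPeriodic N₁ N₂ (un m) := by
    intro m j₁ j₂
    simp only [hun, posx, posy, hperx, hpery, and_self]
  have hvpe : ∀ m, GridPeriodic N₁ N₂ (vn m) := by
    intro m j₁ j₂
    simp only [hvn, posx, posy, hperpx, hperpy, and_self]
  have hw : ∀ m, m + 1 ≤ M → GridPeriodic N₁ N₂
      (fun j => (un (m + 1) j - U (m + 1) j) + (un m j - U m j)) := by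
    intro m hm j₁ j₂
    have a1 := hupe (m + 1) j₁ j₂
    have a2 := hupe m j₁ j₂
    have a3 := (hper (m + 1) hm).1 j₁ j₂
    have a4 := (hper m (by omega)).1 j₁ j₂
    simp only [a1.1, a2.1, a3.1, a4.1, a1.2, a2.2, a3.2, a4.2, and_self]
  have hz : ∀ m, m + 1 ≤ M → GridPeriodic N₁ N₂
      (fun j => (vn (m + 1) j - V (m + 1) j) + (vn m j - V m j)) := by
    intro m hm j₁ j₂
    have a1 := hvpe (m + 1) j₁ j₂
    have a2 := hvpe m j₁ j₂
    have a3 := (hper (m + 1) hm).2.1 j₁ j₂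
    have a4 := (hper m (by omega)).2.1 j₁ j₂
    simp only [a1.1, a2.1, a3.1, a4.1, a1.2, a2.2, a3.2, a4.2, and_self]
  -- the energy
  obtain ⟨D, hD⟩ : ∃ D : ℕ → ℤ × ℤ → ℝ, D = fun m => dens h₁ h₂ (fun j => un m j - U m j)
    (fun j => vn m j - V m j) (fun j => rn m j - R m j) := ⟨_, rfl⟩
  have hD' : ∀ m j, dens h₁ h₂ (fun j => un m j - U m j)
    (fun j => vn m j - V m j) (fun j => rn m j - R m j) j = D m j := fun m j => by rw [hD]
  have hDfg : ∀ m j, (vn m j - V m j) ^ 2 + (rn m j - R m j) ^ 2 ≤ D m j := by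
    intro m j
    rw [hD]
    simp only [dens]
    linarith [sq_nonneg (un m j - U m j), sq_nonneg (dx h₁ (fun j => un m j - U m j) j),
      sq_nonneg (dy h₂ (fun j => un m j - U m j) j)]
  have hDe : ∀ m j, (un m j - U m j) ^ 2 ≤ D m j := by
    intro m j
    rw [hD]
    simp only [dens]
    linarith [sq_nonneg (vn m j - V m j), sq_nonneg (dx h₁ (fun j => un m j - U m j) j),
      sq_nonneg (dy h₂ (fun j => un m j - U m j) j), sq_nonneg (rn m j - R m j)]
  have hDn : ∀ m j, 0 ≤ D m j := fun m j => (sq_nonneg _).trans (hDe m j)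
  have hD0 : ∀ j, D 0 j = 0 := by
    intro j; rw [hD]; simp [dens, dx, dy, hU0, hV0, hR0]
  have hcastt : ∀ m : ℕ, ((m + 1 : ℕ) : ℝ) * τ = m * τ + τ := by intro m; push_cast; ring
  have hrn' : ∀ (n : ℕ) (j : ℤ × ℤ),
      rn n j = rE u (xL + j.1 * h₁, yL + j.2 * h₂, n * τ) := hrn
  obtain ⟨E, hE⟩ : ∃ E : ℕ → ℝ, E = fun m => h₁ * h₂ * gS N₁ N₂ (D m) := ⟨_, rfl⟩
  have hEn : ∀ m, 0 ≤ E m := by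
    intro m; rw [hE]
    exact mul_nonneg (by positivity) (gS_nonneg _ _ _ (hDn m))
  obtain ⟨Q, hQ⟩ : ∃ Q, Q = 45 * A ^ 4 * ε ^ 2 * ((xR - xL) * (yR - yL)) := ⟨_, rfl⟩
  have hQ0 : 0 ≤ Q := by rw [hQ]; positivity
  have hE0 : E 0 = 0 := by
    rw [hE]
    simp [gS, hD0]
  -- first step
  have hE1 : E 1 ≤ 2 * Q := by
    have key := sum_step N₁ N₂ h₁ h₂ (9 * c * τ + 1 / 4) τ (45 * A ^ 4 * ε ^ 2) h1p h2p (D 1) (D 1)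
      _ _ (hw 0 hM) (hz 0 hM) (fun j₁ j₂ hj1 hj2 => by
        have hCj := hC 0 j₁ j₂ hM hj1 hj2
        obtain ⟨η, ζ, hη, hζ, hst⟩ := step_pt u A B xL yL ((0:ℕ) * τ) τ h₁ h₂ hA hB hτp hBl
          ((j₁:ℤ), (j₂:ℤ)) hCj (un 0) (un 1) (vn 0) (vn 1) (rn 0) (rn 1) (U 0) (U 1) (V 0) (V 1)
          (R 0) (R 1) (hun 0)
          (fun j => by rw [hun, ← hcastt]) (hvn 0) (fun j => by rw [hvn, ← hcastt])
          (hrn' 0) (fun j => by rw [hrn', ← hcastt])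
          (un 0 ((j₁:ℤ), (j₂:ℤ))) (U 0 ((j₁:ℤ), (j₂:ℤ))) 0 (A * τ)
          (by
            rw [hun]
            exact half_diff _ _ _ hCj.c7)
          (by rw [hU0]; simp) s10 (s20 _) (s30 _)
        simp only [hD', ← hc, hD0] at hst
        have z1 : vn 0 ((j₁:ℤ), (j₂:ℤ)) - V 0 ((j₁:ℤ), (j₂:ℤ)) = 0 := by rw [hV0]; simp
        have z2 : rn 0 ((j₁:ℤ), (j₂:ℤ)) - R 0 ((j₁:ℤ), (j₂:ℤ)) = 0 := by rw [hR0]; simp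
        rw [z1, z2, add_zero, add_zero, sub_zero, add_zero, zero_pow two_ne_zero, add_zero] at hst
        have b1 : τ * (τ ^ 2 + h₁ ^ 2 + h₂ ^ 2 + A * τ) ≤ 3 * A * ε := by
          have m1 : τ * (τ ^ 2 + h₁ ^ 2 + h₂ ^ 2) ≤ 1 * (τ ^ 2 + h₁ ^ 2 + h₂ ^ 2) :=
            mul_le_mul_of_nonneg_right hτ1 (by positivity)
          have m2 : 1 * ε ≤ A * ε := mul_le_mul_of_nonneg_right hA hε0
          have m3 : A * τ ^ 2 ≤ A * ε := mul_le_mul_of_nonneg_left hετ (by linarith)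
          have m4 := sq_nonneg τ
          linarith
        have b2 : A * (τ * (τ ^ 2 + h₁ ^ 2 + h₂ ^ 2 + A * τ)) ≤ A * (3 * A * ε) :=
          mul_le_mul_of_nonneg_left b1 (by linarith)
        have b3 : 0 ≤ A * (τ * (h₁ ^ 2 + h₂ ^ 2)) := by positivity
        refine tail0 τ c _ _ _ _ η ζ A ε hτp hτ1 hc1 hA hst (hDfg 1 _) hετ ?_ ?_
        · have := mul_le_mul_of_nonneg_left hη hτp.le
          linarith
        · have := mul_le_mul_of_nonneg_left hζ hτp.le
          linarith)
    rw [hNh1, hNh2, ← hQ] at key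
    have hE1' : E 1 = h₁ * h₂ * gS N₁ N₂ (D 1) := by rw [hE]
    rw [← hE1'] at key
    have := mul_le_mul_of_nonneg_right hτc (hEn 1)
    linarith
  -- general step
  have hEs : ∀ m, 1 ≤ m → m + 1 ≤ M →
      E (m + 1) - E m ≤ (9 * c * τ) * (E (m + 1) + E m + E (m - 1)) + (9 * c * τ) * Q := by
    intro m hm1 hmM
    obtain ⟨k, rfl⟩ : ∃ k, m = k + 1 := ⟨m - 1, by omega⟩
    have key := sum_step N₁ N₂ h₁ h₂ (9 * c * τ) τ (45 * A ^ 4 * ε ^ 2 * τ) h1p h2p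
      (fun j => D (k + 1 + 1) j + (-1) * D (k + 1) j)
      (fun j => (D (k + 1 + 1) j + D (k + 1) j) + D k j)
      _ _ (hw (k + 1) hmM) (hz (k + 1) hmM) (fun j₁ j₂ hj1 hj2 => by
        have hCj := hC (k + 1) j₁ j₂ hmM hj1 hj2
        obtain ⟨η, ζ, hη, hζ, hst⟩ := step_pt u A B xL yL ((k + 1 : ℕ) * τ) τ h₁ h₂ hA hB hτp hBl
          ((j₁:ℤ), (j₂:ℤ)) hCj (un (k + 1)) (un (k + 1 + 1)) (vn (k + 1)) (vn (k + 1 + 1))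
          (rn (k + 1)) (rn (k + 1 + 1)) (U (k + 1)) (U (k + 1 + 1)) (V (k + 1)) (V (k + 1 + 1))
          (R (k + 1)) (R (k + 1 + 1)) (hun (k + 1))
          (fun j => by rw [hun, ← hcastt]) (hvn (k + 1)) (fun j => by rw [hvn, ← hcastt])
          (hrn' (k + 1)) (fun j => by rw [hrn', ← hcastt])
          ((3 * un (k + 1) ((j₁:ℤ), (j₂:ℤ)) - un k ((j₁:ℤ), (j₂:ℤ))) / 2)
          ((3 * U (k + 1) ((j₁:ℤ), (j₂:ℤ)) - U k ((j₁:ℤ), (j₂:ℤ))) / 2)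
          (un k ((j₁:ℤ), (j₂:ℤ)) - U k ((j₁:ℤ), (j₂:ℤ))) (A * τ ^ 2)
          (by
            have e0 : ((k + 1 : ℕ) : ℝ) * τ - τ = k * τ := by push_cast; ring
            have h8 := hCj.c8 (by rw [e0]; positivity)
            rw [e0] at h8
            rw [hun, hun]
            dsimp only
            rw [abs_le] at h8 ⊢
            have : 0 ≤ A * τ ^ 2 := by positivity
            constructor <;> linarith)
          (by
            have p1 := neg_abs_le (un (k + 1) ((j₁:ℤ), (j₂:ℤ)) - U (k + 1) ((j₁:ℤ), (j₂:ℤ)))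
            have p2 := le_abs_self (un (k + 1) ((j₁:ℤ), (j₂:ℤ)) - U (k + 1) ((j₁:ℤ), (j₂:ℤ)))
            have p3 := neg_abs_le (un k ((j₁:ℤ), (j₂:ℤ)) - U k ((j₁:ℤ), (j₂:ℤ)))
            have p4 := le_abs_self (un k ((j₁:ℤ), (j₂:ℤ)) - U k ((j₁:ℤ), (j₂:ℤ)))
            rw [abs_le]
            constructor <;> linarith)
          (s1 (k + 1) hm1 (by omega)) (s2 (k + 1) hm1 (by omega) _) (s3 (k + 1) hm1 (by omega) _)
        simp only [hD', ← hc] at hst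
        have b1 : τ ^ 2 + h₁ ^ 2 + h₂ ^ 2 + A * τ ^ 2 ≤ 3 * A * ε := by
          have m2 : 1 * ε ≤ A * ε := mul_le_mul_of_nonneg_right hA hε0
          have m3 : A * τ ^ 2 ≤ A * ε := mul_le_mul_of_nonneg_left hετ (by linarith)
          have m4 := sq_nonneg τ
          linarith
        have b2 : A * (τ ^ 2 + h₁ ^ 2 + h₂ ^ 2 + A * τ ^ 2) ≤ A * (3 * A * ε) :=
          mul_le_mul_of_nonneg_left b1 (by linarith)
        have b3 : 0 ≤ A * (h₁ ^ 2 + h₂ ^ 2) := by positivity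
        have := tail1 τ c _ _ _ _ (D k ((j₁:ℤ), (j₂:ℤ))) _ _ _ _ _ η ζ A ε hτp hc1 hA hst
          (hDfg (k + 1) _) (hDfg (k + 1 + 1) _) (hDe k _) hετ (by linarith) (by linarith)
        linarith)
    rw [hNh1, hNh2] at key
    rw [gS_add, gS_smul, gS_add, gS_add] at key
    have hEe : ∀ i, E i = h₁ * h₂ * gS N₁ N₂ (D i) := fun i => by rw [hE]
    have hq : 1 * (τ * Q) ≤ (9 * c) * (τ * Q) :=
      mul_le_mul_of_nonneg_right (by linarith) (by positivity)
    have hq2 : 45 * A ^ 4 * ε ^ 2 * τ * ((xR - xL) * (yR - yL)) = τ * Q := by rw [hQ]; ring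
    rw [hq2] at key
    simp only [Nat.add_sub_cancel]
    rw [hEe, hEe, hEe]
    linarith
  have hfin := gronwall M (9 * c * τ) Q E (by positivity) hτc hQ0 hEn hE0 hE1 hEs n hn
  have hpow : (1 + 6 * (9 * c * τ)) ^ n ≤ Real.exp (6 * (9 * c) * T) := by
    have e1 : 1 + 6 * (9 * c * τ) ≤ Real.exp (6 * (9 * c * τ)) := by
      rw [add_comm]; exact Real.add_one_le_exp _
    refine (pow_le_pow_left₀ (by positivity) e1 n).trans ?_
    rw [← Real.exp_nat_mul]
    apply Real.exp_le_exp.2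
    have e2 : (n:ℝ) * τ ≤ M * τ := mul_le_mul_of_nonneg_right (by exact_mod_cast hn) hτp.le
    rw [hMτ] at e2
    have e3 := mul_le_mul_of_nonneg_left e2 (by positivity : 0 ≤ 6 * (9 * c))
    linarith
  have hEG : E n ≤ G * ε ^ 2 := by
    have := mul_le_mul_of_nonneg_right hpow (by positivity : 0 ≤ 3 * Q)
    have e : Real.exp (6 * (9 * c) * T) * (3 * Q) = G * ε ^ 2 := by rw [hG, hQ]; ring
    linarith
  refine (norms_le N₁ N₂ h₁ h₂ h1p h2p _ _ _).trans ?_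
  have hEe : h₁ * h₂ * gS N₁ N₂ (dens h₁ h₂ (fun j => un n j - U n j)
    (fun j => vn n j - V n j) (fun j => rn n j - R n j)) = E n := by rw [hE, hD]
  rw [hEe, ← hε, mul_assoc]
  refine mul_le_mul_of_nonneg_left ?_ (by norm_num)
  refine (Real.sqrt_le_sqrt hEG).trans ?_
  rw [Real.sqrt_mul hG0.le, Real.sqrt_sq hε0]
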